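/- Let G be a 3-edge-connected reduced graph of order n ≥ 16 that is not supereulerian, and suppose G has a spanning bipartite subgraph H with bipartition {X, Y} such that |X| ≤ 7, |Y| ≥ |X|, and every vertex v ∈ Y has degree d_H(v) ≥ 3 in H. Then G = H, F(G) = 3, and G contains no 4-cycle; consequently no such G exists (i.e., every 3-edge-connected reduced graph of order at least 16 possessing such a spanning bipartite subgraph is supereulerian). -/

import Mathlib

open scoped Classical

/-- A finite loopless multigraph on vertex type `V`, given by a multiset of edges. -/
structure Multigraph (V : Type) where
  edges : Multiset (Sym2 V)
  loopless : ∀ e ∈ edges, ¬ e.IsDiag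

namespace Multigraph

variable {V W : Type}

/-- The degree of a vertex with respect to a multiset of edges. -/
noncomputable def degIn (E : Multiset (Sym2 V)) (v : V) : ℕ :=
  Multiset.card (E.filter fun e => v ∈ e)

/-- The degree of a vertex in a multigraph. -/
noncomputable def deg (G : Multigraph V) (v : V) : ℕ :=
  degIn G.edges v

/-- All endpoints of the edges in `E` lie in `S`. -/
def Within (S : Set V) (E : Multiset (Sym2 V)) : Prop :=
  ∀ e ∈ E, ∀ v ∈ e, v ∈ S

/-- The graph with vertex set `S` and edge multiset `E` is connected (and spans `S`). -/
def ConnOn (S : Set V) (E : Multiset (Sym2 V)) : Prop :=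
  S.Nonempty ∧ Within S E ∧
    ∀ u ∈ S, ∀ v ∈ S, Relation.ReflTransGen (fun a b => s(a, b) ∈ E) u v

/-- The graph with vertex set `S` and edge multiset `E` is collapsible: for every even subset
`R` of `S` there is a spanning connected subgraph whose set of odd-degree vertices is `R`. -/
def CollapsiblePair (S : Set V) (E : Multiset (Sym2 V)) : Prop :=
  S.Nonempty ∧ Within S E ∧
    ∀ R : Set V, R ⊆ S → R.Finite → Even R.ncard →
      ∃ E' ≤ E, ConnOn S E' ∧ ∀ x ∈ S, (Odd (degIn E' x) ↔ x ∈ R)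

/-- `(S, E)` is a subgraph of `G`. -/
def IsSubpair (G : Multigraph V) (S : Set V) (E : Multiset (Sym2 V)) : Prop :=
  E ≤ G.edges ∧ Within S E

/-- A multigraph is reduced if it has no collapsible subgraph with more than one vertex. -/
def Reduced (G : Multigraph V) : Prop :=
  ∀ S E, G.IsSubpair S E → CollapsiblePair S E → S.ncard ≤ 1

/-- `(S, E)` is a maximal collapsible subgraph of `G`. -/
def MaxCollapsibleSub (G : Multigraph V) (S : Set V) (E : Multiset (Sym2 V)) : Prop :=
  G.IsSubpair S E ∧ CollapsiblePair S E ∧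
    ∀ S' E', G.IsSubpair S' E' → CollapsiblePair S' E' → S ⊆ S' → E ≤ E' → S' = S ∧ E' = E

/-- `(S, E)` is a nontrivial maximal collapsible subgraph of `G`. -/
def NontrivMaxCollapsible (G : Multigraph V) (S : Set V) (E : Multiset (Sym2 V)) : Prop :=
  G.MaxCollapsibleSub S E ∧ 1 < S.ncard

/-- The multiset of edges of `G` with both ends in `S`. -/
noncomputable def inducedEdges (G : Multigraph V) (S : Set V) : Multiset (Sym2 V) :=
  G.edges.filter fun e => ∀ v ∈ e, v ∈ S

/-- `S` is the vertex set of a maximal collapsible subgraph of `G`. -/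
def IsMaxCollapsibleSet (G : Multigraph V) (S : Set V) : Prop :=
  CollapsiblePair S (G.inducedEdges S) ∧
    ∀ T : Set V, S ⊆ T → CollapsiblePair T (G.inducedEdges T) → T = S

/-- `G'` (on vertex type `W`) is the reduction of `G`, witnessed by the contraction map `f`:
the fibres of `f` are exactly the (vertex sets of the) maximal collapsible subgraphs of `G`,
and the edges of `G'` are obtained by contracting each fibre to a point and deleting the
resulting loops. -/
def IsReduction (G : Multigraph V) (f : V → W) (G' : Multigraph W) : Prop :=
  Function.Surjective f ∧ (∀ w : W, G.IsMaxCollapsibleSet (f ⁻¹' {w})) ∧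
    G'.edges = (G.edges.map (Sym2.map f)).filter fun e => ¬ e.IsDiag

/-- A multigraph is supereulerian if it has a spanning connected subgraph in which every
vertex has even degree. -/
def Supereulerian (G : Multigraph V) : Prop :=
  ∃ E' ≤ G.edges, ConnOn Set.univ E' ∧ ∀ x : V, Even (degIn E' x)

/-- A multigraph is connected. -/
def Connected (G : Multigraph V) : Prop :=
  ConnOn Set.univ G.edges

/-- A multigraph is 3-edge-connected (edge connectivity at least 3): removing any at most two
edges leaves a spanning connected graph. -/
def ThreeEdgeConnected (G : Multigraph V) : Prop :=
  ∀ F : Multiset (Sym2 V), F ≤ G.edges → Multiset.card F ≤ 2 →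
    ConnOn Set.univ (G.edges - F)

/-- A spanning tree: spanning connected with `|V| - 1` edges. -/
def IsSpanningTree [Fintype V] (E : Multiset (Sym2 V)) : Prop :=
  ConnOn Set.univ E ∧ Multiset.card E = Fintype.card V - 1

/-- The edge multiset `E` contains two edge-disjoint spanning trees. -/
def HasTwoDisjointSpanningTrees [Fintype V] (E : Multiset (Sym2 V)) : Prop :=
  ∃ T₁ T₂ : Multiset (Sym2 V), T₁ + T₂ ≤ E ∧ IsSpanningTree T₁ ∧ IsSpanningTree T₂

/-- `F(G)`: the minimum number of extra (loopless) edges whose addition to `G` produces a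
spanning supergraph having two edge-disjoint spanning trees. -/
noncomputable def FVal [Fintype V] (G : Multigraph V) : ℕ :=
  sInf {k : ℕ | ∃ Eadd : Multiset (Sym2 V), (∀ e ∈ Eadd, ¬ e.IsDiag) ∧
    Multiset.card Eadd = k ∧ HasTwoDisjointSpanningTrees (G.edges + Eadd)}

/-- `σ̄₂(G)`: the minimum of `deg u + deg v` over edges `uv` of `G`. -/
noncomputable def sigma2bar (G : Multigraph V) : ℕ :=
  sInf {k : ℕ | ∃ u v : V, s(u, v) ∈ G.edges ∧ G.deg u + G.deg v = k}

/-- `G` contains a cycle of length four. -/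
def HasFourCycle (G : Multigraph V) : Prop :=
  ∃ a b c d : V, a ≠ b ∧ a ≠ c ∧ a ≠ d ∧ b ≠ c ∧ b ≠ d ∧ c ≠ d ∧
    s(a, b) ∈ G.edges ∧ s(b, c) ∈ G.edges ∧ s(c, d) ∈ G.edges ∧ s(d, a) ∈ G.edges

/-- `M` is a matching: distinct edges share no endpoint. -/
def IsMatching (M : Multiset (Sym2 V)) : Prop :=
  M.Nodup ∧ ∀ e ∈ M, ∀ f ∈ M, e ≠ f → ∀ x : V, x ∈ e → x ∉ f

/-- `{X, Y}` is a bipartition (of the full vertex set) for the edge multiset `E`: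
every edge has one end in `X` and one end in `Y`. -/
def IsBipartition [Fintype V] (X Y : Finset V) (E : Multiset (Sym2 V)) : Prop :=
  Disjoint X Y ∧ X ∪ Y = Finset.univ ∧
    ∀ e ∈ E, (∃ a ∈ e, a ∈ X) ∧ (∃ b ∈ e, b ∈ Y)

/-- The edge multiset of Catlin's π-reduction `G/π` obtained from the induced four-cycle
`u v z w`: remove the four cycle edges, identify `z` with `u` (forming `x = u`) and `w` with
`v` (forming `y = v`), and add the new edge `e_π = xy = s(u, v)`. -/
noncomputable def piEdges (G : Multigraph V) (u v z w : V) : Multiset (Sym2 V) :=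
  ((G.edges - {s(u, v), s(v, z), s(z, w), s(w, u)}).map
      (Sym2.map fun a => if a = z then u else if a = w then v else a)) + {s(u, v)}

/-- `(S, E)` is the multigraph `Φ(c, t)`: a star `K_{1,t}` with centre `c` in which every
edge is doubled. -/
def IsPhi (S : Set V) (E : Multiset (Sym2 V)) (c : V) (t : ℕ) : Prop :=
  ∃ A : Finset V, c ∉ A ∧ A.card = t ∧ S = insert c (↑A : Set V) ∧
    E = A.val.map (fun a => s(c, a)) + A.val.map (fun a => s(c, a))

/-- The multigraph associated with a simple graph. -/
noncomputable def ofSimple [Fintype V] (G : SimpleGraph V) : Multigraph V where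
  edges := G.edgeSet.toFinset.val
  loopless := by
    intro e he
    have he' : e ∈ G.edgeSet := by simpa using he
    exact G.not_isDiag_of_mem_edgeSet he'

/-- Isomorphism of multigraphs. -/
def MIso {A B : Type} (G : Multigraph A) (H : Multigraph B) : Prop :=
  ∃ φ : A ≃ B, H.edges = G.edges.map (Sym2.map φ)

end Multigraph

/-- Vertices of the Petersen graph: the 2-element subsets of a 5-element set. -/
abbrev PetersenVert : Type := {s : Finset (Fin 5) // s.card = 2}

/-- The Petersen graph (as the Kneser graph on 2-subsets of a 5-set). -/
def petersenSimple : SimpleGraph PetersenVert :=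
  SimpleGraph.fromRel fun a b => Disjoint a.1 b.1

noncomputable def petersen : Multigraph PetersenVert :=
  Multigraph.ofSimple petersenSimple

/-- The graph `P₁₄`: obtained from the Petersen graph (outer cycle `0 1 2 3 4`, spokes
`i — i+5`, inner cycle `5 7 9 6 8 5`) by replacing the vertex `9` (whose neighbours were
`4`, `7`, `6`) by a copy of `K_{2,3}` with degree-three vertices `9`, `10` and degree-two
vertices `11`, `12`, `13`, joined to `4`, `7`, `6` respectively. -/
def p14Simple : SimpleGraph (Fin 14) :=
  SimpleGraph.fromRel fun a b =>
    (a, b) ∈ ([(0, 1), (1, 2), (2, 3), (3, 4), (4, 0), (0, 5), (1, 6), (2, 7), (3, 8),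
      (5, 7), (6, 8), (8, 5), (9, 11), (9, 12), (9, 13), (10, 11), (10, 12), (10, 13),
      (11, 4), (12, 7), (13, 6)] : List (Fin 14 × Fin 14))

noncomputable def p14 : Multigraph (Fin 14) :=
  Multigraph.ofSimple p14Simple

namespace Hyp

theorem z2cases (z : ZMod 2) : z = 0 ∨ z = 1 := by
  fin_cases z
  · exact Or.inl rfl
  · exact Or.inr rfl

theorem z2add (z : ZMod 2) : z + z = 0 := CharTwo.add_self_eq_zero z

/-- lifting a permutation through a map -/
theorem perm_lift {α β : Type*} (f : α → β) : ∀ (l : List α) (m : List β), (l.map f).Perm m →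
    ∃ l' : List α, l'.Perm l ∧ l'.map f = m := by
  intro l m h
  have h2 : List.Forall₂ (fun (b : β) (a : α) => f a = b) (l.map f) l := by
    induction l with
    | nil => simp
    | cons x l ih => simp
  have := List.perm_comp_forall₂ h.symm h2
  obtain ⟨w, hw1, hw2⟩ := this
  refine ⟨w, hw2, ?_⟩
  clear h h2 hw2
  induction hw1 with
  | nil => rfl
  | cons h _ ih => simp [h, ih]

/-- every invariant colouring of the hypergraph with hyperedges `C` is constant -/
def Conn (P : Finset ℕ) (C : List (List ℕ)) : Prop :=
  ∀ (g : ℕ → ZMod 2) (K : List (List ℕ × ZMod 2)), K.map Prod.fst = C →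
    (∀ k ∈ K, ∀ u ∈ k.1, g u = k.2) → ∃ t, (∀ u ∈ P, g u = t) ∧ ∀ k ∈ K, k.2 = t

/-- collapsibility of a hypergraph (i.e. of its incidence graph) -/
def Coll (P : Finset ℕ) (L : List (List ℕ)) : Prop :=
  ∀ (D : List (List ℕ × ZMod 2)) (R : ℕ → ZMod 2), D.map Prod.fst = L →
    ∑ x ∈ P, R x = (D.map Prod.snd).sum →
    ∃ Q : List ((List ℕ × ZMod 2) × List ℕ), Q.map Prod.fst = D ∧
      (∀ q ∈ Q, q.2.Subperm q.1.1 ∧ (q.2.length : ZMod 2) = q.1.2) ∧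
      (∀ x ∈ P, ((Q.map Prod.snd).flatten.count x : ZMod 2) = R x) ∧
      Conn P (Q.map Prod.snd)

theorem Conn.perm {P : Finset ℕ} {C C' : List (List ℕ)} (h : Conn P C) (hp : C.Perm C') :
    Conn P C' := by
  intro g K hK hg
  obtain ⟨K', hK', hm⟩ := perm_lift Prod.fst K C (by rw [hK]; exact hp.symm)
  obtain ⟨t, h1, h2⟩ := h g K' hm (fun k hk => hg k (hK'.mem_iff.1 hk))
  exact ⟨t, h1, fun k hk => h2 k (hK'.mem_iff.2 hk)⟩

theorem Coll.perm {P : Finset ℕ} {L L' : List (List ℕ)} (h : Coll P L) (hp : L.Perm L') :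
    Coll P L' := by
  intro D R hD hs
  obtain ⟨D', hD', hm⟩ := perm_lift Prod.fst D L (by rw [hD]; exact hp.symm)
  obtain ⟨Q', hQ', hv, hc, hco⟩ := h D' R hm (by rw [hs]; exact ((hD'.map _).sum_eq).symm)
  obtain ⟨Q, hQ, hQm⟩ := perm_lift Prod.fst Q' D (by rw [hQ']; exact hD')
  refine ⟨Q, hQm, fun q hq => hv q (hQ.mem_iff.1 hq), fun x hx => ?_, hco.perm (hQ.symm.map _)⟩
  rw [← hc x hx, ((hQ.map Prod.snd).flatten).count_eq]

theorem Coll.perm_head {P : Finset ℕ} {e e' : List ℕ} {L : List (List ℕ)} (h : Coll P (e :: L))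
    (hp : e.Perm e') : Coll P (e' :: L) := by
  intro D R hD hs
  match D, hD with
  | d :: D', hD =>
    simp only [List.map_cons, List.cons.injEq] at hD
    obtain ⟨hd, hD⟩ := hD
    obtain ⟨Q, hQ, hv, hc, hco⟩ := h ((e, d.2) :: D') R (by simp [hD]) (by simpa using hs)
    match Q, hQ with
    | q :: Q', hQ =>
      simp only [List.map_cons, List.cons.injEq] at hQ
      obtain ⟨hq, hQ⟩ := hQ
      refine ⟨(d, q.2) :: Q', by simp [hQ], ?_, by simpa using hc, by simpa using hco⟩
      intro q' hq'
      rcases List.mem_cons.1 hq' with rfl | hq'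
      · have := hv q (by simp)
        rw [hq] at this
        refine ⟨?_, this.2⟩
        simp only [hd]
        exact this.1.trans hp.subperm
      · exact hv q' (by simp [hq'])

theorem Coll.base (a : ℕ) (L : List (List ℕ)) (h : ∀ e ∈ L, 2 ≤ e.length ∧ ∀ x ∈ e, x = a) :
    Coll {a} L := by
  intro D R hD hs
  have key : ∀ D : List (List ℕ × ZMod 2),
      (∀ e ∈ D.map Prod.fst, 2 ≤ e.length ∧ ∀ x ∈ e, x = a) →
      ∃ Q : List ((List ℕ × ZMod 2) × List ℕ), Q.map Prod.fst = D ∧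
      (∀ q ∈ Q, q.2.Subperm q.1.1 ∧ (q.2.length : ZMod 2) = q.1.2 ∧ q.2 ≠ [] ∧ ∀ x ∈ q.2, x = a) ∧
      ((Q.map Prod.snd).flatten.count a : ZMod 2) = (D.map Prod.snd).sum := by
    intro D
    induction D with
    | nil => intro _; exact ⟨[], by simp⟩
    | cons d D ih =>
      intro hD
      obtain ⟨Q, hQ, hv, hc⟩ := ih (fun e he => hD e (by simp at he ⊢; tauto))
      obtain ⟨h2, ha⟩ := hD d.1 (by simp)
      have hrep : d.1 = List.replicate d.1.length a := List.eq_replicate_iff.2 ⟨rfl, ha⟩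
      have hz : ∃ n : ℕ, 1 ≤ n ∧ n ≤ 2 ∧ (n : ZMod 2) = d.2 := by
        rcases z2cases d.2 with h | h
        · exact ⟨2, by norm_num, le_rfl, by rw [h]; rfl⟩
        · exact ⟨1, le_rfl, by norm_num, by rw [h]; rfl⟩
      obtain ⟨n, hn1, hn2, hnz⟩ := hz
      refine ⟨(d, List.replicate n a) :: Q, by simp [hQ], ?_, ?_⟩
      · intro q hq
        rcases List.mem_cons.1 hq with rfl | hq
        · refine ⟨?_, by simpa using hnz, by simp; omega, ?_⟩
          · rw [hrep]
            exact (List.Sublist.subperm (List.replicate_sublist_replicate a |>.2 (by omega)))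
          · intro x hx; exact List.eq_of_mem_replicate hx
        · exact hv q hq
      · simp [hc, hnz, List.count_append]
  obtain ⟨Q, hQ, hv, hc⟩ := key D (by rw [hD]; exact h)
  refine ⟨Q, hQ, fun q hq => ⟨(hv q hq).1, (hv q hq).2.1⟩, ?_, ?_⟩
  · intro x hx
    rw [Finset.mem_singleton] at hx
    subst hx
    rw [hc, ← hs]; simp
  · intro g K hK hg
    refine ⟨g a, by simp, ?_⟩
    intro k hk
    have : k.1 ∈ Q.map Prod.snd := by rw [← hK]; exact List.mem_map_of_mem hk
    obtain ⟨q, hq, hqk⟩ := List.mem_map.1 this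
    obtain ⟨_, _, hne, hall⟩ := hv q hq
    obtain ⟨x, hx⟩ := List.exists_mem_of_ne_nil _ hne
    rw [← hg k hk x (by rw [← hqk]; exact hx), hall x hx]

theorem subperm_map_lift {f : ℕ → ℕ} {c' e : List ℕ} (h : c'.Subperm (e.map f)) :
    ∃ c : List ℕ, c.Subperm e ∧ c.map f = c' := by
  obtain ⟨s, hs, hsub⟩ := h
  obtain ⟨s0, hs0, rfl⟩ := List.sublist_map_iff.1 hsub
  obtain ⟨c, hc, hm⟩ := perm_lift f s0 c' hs
  exact ⟨c, hc.subperm.trans hs0.subperm, hm⟩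

theorem lift_rest (f : ℕ → ℕ) : ∀ (D : List (List ℕ × ZMod 2))
    (Q' : List ((List ℕ × ZMod 2) × List ℕ)),
    Q'.map Prod.fst = D.map (fun d => (d.1.map f, d.2)) →
    (∀ q ∈ Q', q.2.Subperm q.1.1 ∧ (q.2.length : ZMod 2) = q.1.2) →
    ∃ Q : List ((List ℕ × ZMod 2) × List ℕ), Q.map Prod.fst = D ∧
      (∀ q ∈ Q, q.2.Subperm q.1.1 ∧ (q.2.length : ZMod 2) = q.1.2) ∧
      (Q.map Prod.snd).map (List.map f) = Q'.map Prod.snd := by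
  intro D
  induction D with
  | nil => intro Q' h _; simp at h; subst h; exact ⟨[], by simp⟩
  | cons d D ih =>
    intro Q' h hv
    match Q', h with
    | q :: Q'', h =>
      simp only [List.map_cons, List.cons.injEq] at h
      obtain ⟨Q, h1, h2, h3⟩ := ih Q'' h.2 (fun q hq => hv q (by simp [hq]))
      have hq := hv q (by simp)
      rw [h.1] at hq
      obtain ⟨c, hc, hcm⟩ := subperm_map_lift hq.1
      refine ⟨(d, c) :: Q, by simp [h1], ?_, by simp [hcm, ← h3]⟩
      intro q' hq'
      rcases List.mem_cons.1 hq' with rfl | hq'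
      · refine ⟨hc, ?_⟩
        have := hq.2
        rw [← hcm] at this
        simpa using this
      · exact h2 q' hq'

theorem subperm_append_split {c x y : List ℕ} (h : c.Subperm (x ++ y)) :
    ∃ c1 c2, c.Perm (c1 ++ c2) ∧ c1.Subperm x ∧ c2.Subperm y := by
  obtain ⟨s, hs, hsub⟩ := h
  obtain ⟨s1, s2, rfl, h1, h2⟩ := List.sublist_append_iff.1 hsub
  exact ⟨s1, s2, hs.symm, h1.subperm, h2.subperm⟩

theorem zrow : ∀ k1 k2 k1' k2' : ZMod 2, ¬ (k1 = k2) → ¬ (k1' = k2') →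
    k1 + k1' = k2 + k2' ∧ ¬ (k1 + k2' = k1 + k1') := by decide

theorem zcol : ∀ x y z w : ZMod 2, ¬ (x = y) → ¬ (z = w) →
    x + z = y + w ∧ ¬ (x + z = x + w) := by decide

theorem zeq0 : ∀ p q : ZMod 2, p + q = 0 → q = p := by decide

theorem zeq1 : ∀ p q : ZMod 2, p + q = 1 → (p = 0 ∧ q = 1) ∨ (p = 1 ∧ q = 0) := by decide

theorem zdiag : ∀ x y z w : ZMod 2, ¬ (x = y) → ¬ (w = z) →
    x + w = y + z ∧ x + z = y + w ∧ ¬ (x + z = x + w) := by decide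

theorem zipK (g g' : ℕ → ZMod 2) : ∀ (K K' : List (List ℕ × ZMod 2)),
    K.map Prod.fst = K'.map Prod.fst → (∀ k ∈ K, ∀ u ∈ k.1, g u = k.2) →
    (∀ k ∈ K', ∀ u ∈ k.1, g' u = k.2) →
    ∃ K'' : List (List ℕ × ZMod 2), K''.map Prod.fst = K.map Prod.fst ∧
      ∀ k ∈ K'', ∀ u ∈ k.1, g u + g' u = k.2 := by
  intro K
  induction K with
  | nil => intro K' _ _ _; exact ⟨[], by simp⟩
  | cons k K ih =>
    intro K' h h1 h2
    match K', h with
    | k' :: K', h =>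
      simp only [List.map_cons, List.cons.injEq] at h
      obtain ⟨K'', a1, a2⟩ := ih K' h.2 (fun k hk => h1 k (by simp [hk]))
        (fun k hk => h2 k (by simp [hk]))
      refine ⟨(k.1, k.2 + k'.2) :: K'', by simp [a1], ?_⟩
      intro q hq
      rcases List.mem_cons.1 hq with rfl | hq
      · intro u hu
        simp only at hu ⊢
        rw [h1 k (by simp) u hu, h2 k' (by simp) u (by rw [← h.1]; exact hu)]
      · exact a2 q hq

/-- the two-by-two correction -/
theorem core {P : Finset ℕ} {a b : ℕ} (hab : a ≠ b) (haP : a ∈ P) (hbP : b ∈ P) (s1 s2 : List ℕ)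
    (cr : List (List ℕ)) (ε : ZMod 2)
    (hconn : ∀ (g : ℕ → ZMod 2) (k : ZMod 2) (K : List (List ℕ × ZMod 2)),
      K.map Prod.fst = cr → g a = g b → (ε = 1 → g a = k) → (∀ u ∈ s1, g u = k) →
      (∀ u ∈ s2, g u = k) → (∀ k ∈ K, ∀ u ∈ k.1, g u = k.2) →
      ∃ t, (∀ u ∈ P, g u = t) ∧ k = t ∧ ∀ k ∈ K, k.2 = t)
    (p q r s : ZMod 2) (hpq : p + q = ε) (hrs : r + s = ε) :
    ∃ D1 D2 : List ℕ, D1.Sublist [a, b] ∧ D2.Sublist [a, b] ∧ (D1.length : ZMod 2) = p ∧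
      (D2.length : ZMod 2) = q ∧ ((D1 ++ D2).count a : ZMod 2) = r ∧
      ((D1 ++ D2).count b : ZMod 2) = s ∧ Conn P ((D1 ++ s1) :: (D2 ++ s2) :: cr) := by
  have hba : b ≠ a := hab.symm
  have two : ((2 : ℕ) : ZMod 2) = 0 := rfl
  have two' : (2 : ZMod 2) = 0 := rfl
  have h10 : (1 : ZMod 2) ≠ 0 := one_ne_zero
  -- sufficient criterion
  have hok : ∀ D1 D2 : List ℕ, (∀ (g : ℕ → ZMod 2) (k1 k2 : ZMod 2)
      (K : List (List ℕ × ZMod 2)), K.map Prod.fst = cr → (∀ u ∈ D1, g u = k1) →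
      (∀ u ∈ D2, g u = k2) → (∀ u ∈ s1, g u = k1) → (∀ u ∈ s2, g u = k2) →
      (∀ k ∈ K, ∀ u ∈ k.1, g u = k.2) → k1 = k2 ∧ g a = g b ∧ (ε = 1 → g a = k1)) →
      Conn P ((D1 ++ s1) :: (D2 ++ s2) :: cr) := by
    intro D1 D2 h g K hK hg
    match K, hK with
    | [κ1], hK => simp at hK
    | κ1 :: κ2 :: K, hK =>
      simp only [List.map_cons, List.cons.injEq] at hK
      obtain ⟨e1, e2, e3⟩ := hK
      have f1 := hg κ1 (by simp)
      have f2 := hg κ2 (by simp)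
      rw [e1] at f1; rw [e2] at f2
      have f3 : ∀ k ∈ K, ∀ u ∈ k.1, g u = k.2 := fun k hk => hg k (by simp [hk])
      have f4 : ∀ u ∈ s1, g u = κ1.2 := fun u hu => f1 u (by simp [hu])
      have f5 : ∀ u ∈ s2, g u = κ2.2 := fun u hu => f2 u (by simp [hu])
      obtain ⟨i1, i2, i3⟩ := h g κ1.2 κ2.2 K e3 (fun u hu => f1 u (by simp [hu]))
        (fun u hu => f2 u (by simp [hu])) f4 f5 f3
      obtain ⟨t, t1, t2, t3⟩ := hconn g κ1.2 K e3 i2 i3 f4 (by rw [i1]; exact f5) f3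
      refine ⟨t, t1, ?_⟩
      intro k hk
      simp only [List.mem_cons] at hk
      rcases hk with rfl | rfl | hk
      · exact t2
      · rw [← i1]; exact t2
      · exact t3 k hk
  -- two options
  have htwo : ε = 0 → ∀ D1 D2 D1' D2' : List ℕ,
      (∀ (g g' : ℕ → ZMod 2) (k1 k2 k1' k2' : ZMod 2), (∀ u ∈ D1, g u = k1) →
        (∀ u ∈ D2, g u = k2) → (∀ u ∈ D1', g' u = k1') → (∀ u ∈ D2', g' u = k2') →
        ¬ (k1 = k2 ∧ g a = g b) → ¬ (k1' = k2' ∧ g' a = g' b) →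
        k1 + k1' = k2 + k2' ∧ g a + g' a = g b + g' b ∧
          ¬ (g a + g' a = k1 + k1' ∧ g b + g' b = k1 + k1')) →
      Conn P ((D1 ++ s1) :: (D2 ++ s2) :: cr) ∨ Conn P ((D1' ++ s1) :: (D2' ++ s2) :: cr) := by
    intro hε D1 D2 D1' D2' h
    by_contra hcon
    rw [not_or] at hcon
    obtain ⟨c1, c2⟩ := hcon
    have c1 := mt (hok D1 D2) c1
    have c2 := mt (hok D1' D2') c2
    push Not at c1 c2
    obtain ⟨g, k1, k2, K, a1, a2, a3, a4, a5, a6, a7⟩ := c1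
    obtain ⟨g', k1', k2', K', b1, b2, b3, b4, b5, b6, b7⟩ := c2
    have z : ¬ (ε = 1) := by rw [hε]; exact zero_ne_one
    obtain ⟨K'', d1, d2⟩ := zipK g g' K K' (by rw [a1, b1]) a6 b6
    obtain ⟨j1, j2, j3⟩ := h g g' k1 k2 k1' k2' a2 a3 b2 b3
      (fun ⟨x, y⟩ => z (a7 x y).1) (fun ⟨x, y⟩ => z (b7 x y).1)
    obtain ⟨t, t1, t2, -⟩ := hconn (fun u => g u + g' u) (k1 + k1') K'' (by rw [d1, a1]) j2
      (fun x => (z x).elim) (fun u hu => by rw [a4 u hu, b4 u hu])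
      (fun u hu => by rw [a5 u hu, b5 u hu, j1]) d2
    exact j3 ⟨by rw [t2]; exact t1 a haP, by rw [t2]; exact t1 b hbP⟩
  have hz := z2cases
  have Sab : [a, b].Sublist [a, b] := List.Sublist.refl _
  have Sa : [a].Sublist [a, b] := by simp
  have Sb : [b].Sublist [a, b] := by simp
  have S0 : ([] : List ℕ).Sublist [a, b] := by simp
  rcases z2cases ε with hε | hε
  · have hp : q = p := zeq0 p q (hpq.trans hε)
    have hr : s = r := zeq0 r s (hrs.trans hε)
    rw [hp, hr]
    rcases hz p with h | h <;> rcases hz r with h' | h' <;> rw [h, h']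
    · refine ⟨[a, b], [a, b], Sab, Sab, two, two, by simp [hba, two'], by simp [hab, two'],
        hok _ _ ?_⟩
      intro g k1 k2 K _ h1 h2 _ _ _
      simp at h1 h2
      refine ⟨by rw [← h1.1, h2.1], by rw [h1.1, h1.2], fun _ => h1.1⟩
    · rcases htwo hε [a, b] [] [] [a, b] (by
        intro g g' k1 k2 k1' k2' h1 h2 h3 h4 n1 n2
        simp at h1 h2 h3 h4
        have e1 : g a = g b := by rw [h1.1, h1.2]
        have e2 : g' a = g' b := by rw [h4.1, h4.2]
        obtain ⟨m1, m2⟩ := zrow k1 k2 k1' k2' (fun h => n1 ⟨h, e1⟩) (fun h => n2 ⟨h, e2⟩)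
        refine ⟨m1, by rw [e1, e2], fun h => m2 ?_⟩
        rw [← h.1, h1.1, h4.1]) with hh | hh
      · exact ⟨_, _, Sab, S0, two, by simp, by simp [hba], by simp [hab], hh⟩
      · exact ⟨_, _, S0, Sab, by simp, two, by simp [hba], by simp [hab], hh⟩
    · rcases htwo hε [a] [a] [b] [b] (by
        intro g g' k1 k2 k1' k2' h1 h2 h3 h4 n1 n2
        simp at h1 h2 h3 h4
        subst h1; subst h3
        rw [← h2, ← h4]
        obtain ⟨m1, m2⟩ := zcol (g a) (g b) (g' a) (g' b) (fun h => n1 ⟨h2, h⟩)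
          (fun h => n2 ⟨h4, h⟩)
        exact ⟨rfl, m1, fun h => m2 h.1⟩) with hh | hh
      · exact ⟨_, _, Sa, Sa, by simp, by simp, by simp [two'], by simp [hab], hh⟩
      · exact ⟨_, _, Sb, Sb, by simp, by simp, by simp [hba], by simp [two'], hh⟩
    · rcases htwo hε [a] [b] [b] [a] (by
        intro g g' k1 k2 k1' k2' h1 h2 h3 h4 n1 n2
        simp at h1 h2 h3 h4
        subst h1; subst h2; subst h3; subst h4
        obtain ⟨m1, m2, m3⟩ := zdiag (g a) (g b) (g' a) (g' b) (fun h => n1 ⟨h, h⟩)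
          (fun h => n2 ⟨h, h.symm⟩)
        exact ⟨m1, m2, fun h => m3 h.1⟩) with hh | hh
      · exact ⟨_, _, Sa, Sb, by simp, by simp, by simp [hba], by simp [hab], hh⟩
      · exact ⟨_, _, Sb, Sa, by simp, by simp, by simp [hba], by simp [hab], hh⟩
  · have hp := zeq1 p q (hpq.trans hε)
    have hr := zeq1 r s (hrs.trans hε)
    rcases hp with ⟨h, h'⟩ | ⟨h, h'⟩ <;> rcases hr with ⟨h2, h2'⟩ | ⟨h2, h2'⟩ <;> rw [h, h', h2, h2']
    · refine ⟨[a, b], [a], Sab, Sa, two, by simp, by simp [hba, two'], by simp [hab], hok _ _ ?_⟩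
      intro g k1 k2 K _ h1 h2 _ _ _
      simp at h1 h2
      exact ⟨by rw [← h1.1, h2], by rw [h1.1, h1.2], fun _ => h1.1⟩
    · refine ⟨[a, b], [b], Sab, Sb, two, by simp, by simp [hba], by simp [hab, two'], hok _ _ ?_⟩
      intro g k1 k2 K _ h1 h2 _ _ _
      simp at h1 h2
      exact ⟨by rw [← h1.2, h2], by rw [h1.1, h1.2], fun _ => h1.1⟩
    · refine ⟨[a], [a, b], Sa, Sab, by simp, two, by simp [hba, two'], by simp [hab], hok _ _ ?_⟩
      intro g k1 k2 K _ h1 h2 _ _ _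
      simp at h1 h2
      exact ⟨by rw [← h1, h2.1], by rw [h2.1, h2.2], fun _ => h1⟩
    · refine ⟨[b], [a, b], Sb, Sab, by simp, two, by simp [hba], by simp [hab, two'], hok _ _ ?_⟩
      intro g k1 k2 K _ h1 h2 _ _ _
      simp at h1 h2
      exact ⟨by rw [← h1, h2.2], by rw [h2.1, h2.2], fun _ => by rw [h2.1, ← h2.2, h1]⟩

theorem count_map_if (a b x : ℕ) (hab : a ≠ b) (l : List ℕ) (hx : x ≠ b) :
    (l.map (fun y => if y = b then a else y)).count x =
      l.count x + if x = a then l.count b else 0 := by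
  induction l with
  | nil => simp
  | cons y l ih =>
    simp only [List.map_cons, List.count_cons, ih, beq_iff_eq]
    by_cases h1 : y = b <;> by_cases h2 : x = a <;> by_cases h3 : y = x <;>
      simp [h1, h2, h3] <;> grind

theorem Coll.pi {P : Finset ℕ} {a b : ℕ} (hab : a ≠ b) (haP : a ∈ P) (hbP : b ∈ P)
    (l1 l2 : List ℕ) (L : List (List ℕ))
    (h : Coll (P.erase b) ((a :: (l1 ++ l2)).map (fun y => if y = b then a else y) ::
      L.map (List.map (fun y => if y = b then a else y)))) :
    Coll P ((a :: b :: l1) :: (a :: b :: l2) :: L) := by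
  intro D R hD hs
  match D, hD with
  | [d1], hD => simp at hD
  | d1 :: d2 :: D, hD =>
  simp only [List.map_cons, List.cons.injEq] at hD
  obtain ⟨e1, e2, e3⟩ := hD
  obtain ⟨Q', hQ', hv, hc, hco⟩ := h (((a :: (l1 ++ l2)).map (fun y => if y = b then a else y),
    d1.2 + d2.2) :: D.map (fun d => (d.1.map (fun y => if y = b then a else y), d.2)))
    (fun x => if x = a then R a + R b else R x)
    (by simp [← e3, Function.comp_def])
    (by
      have haE : a ∈ P.erase b := Finset.mem_erase.2 ⟨hab, haP⟩
      rw [← Finset.add_sum_erase _ _ haE]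
      rw [← Finset.add_sum_erase _ _ hbP, ← Finset.add_sum_erase _ _ haE] at hs
      have : ∑ x ∈ (P.erase b).erase a, (if x = a then R a + R b else R x) =
          ∑ x ∈ (P.erase b).erase a, R x := by
        apply Finset.sum_congr rfl
        intro x hx
        rw [if_neg (Finset.mem_erase.1 hx).1]
      rw [this, if_pos rfl]
      simp only [List.map_cons, List.sum_cons, List.map_map, Function.comp_def] at hs ⊢
      have e : R a + R b + ∑ x ∈ (P.erase b).erase a, R x =
        R b + (R a + ∑ x ∈ (P.erase b).erase a, R x) := by ring
      rw [e, hs]; ring)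
  match Q', hQ' with
  | q :: Q', hQ' =>
  rw [List.map_cons] at hQ'
  obtain ⟨hq1, hQ'⟩ := List.cons.inj hQ'
  have hvq := hv q (by simp)
  rw [hq1] at hvq
  obtain ⟨Qr, r1, r2, r3⟩ := lift_rest _ D Q' hQ' (fun q hq => hv q (by simp [hq]))
  obtain ⟨c, hcs, hcm⟩ := subperm_map_lift hvq.1
  obtain ⟨E, s, hEs, hE, hss⟩ := subperm_append_split (x := [a]) (y := l1 ++ l2) hcs
  obtain ⟨s1, s2, hs12, hs1, hs2⟩ := subperm_append_split hss
  have hcp : c.Perm (E ++ (s1 ++ s2)) := hEs.trans (hs12.append_left E)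
  have hE' : E = [] ∨ E = [a] := by
    obtain ⟨E0, hp, hsu⟩ := hE
    rcases List.sublist_singleton.1 hsu with rfl | rfl
    · left; exact List.nil_perm.1 hp
    · right; exact (List.singleton_perm.1 hp).symm
  have hlen : (E.length : ZMod 2) + s1.length + s2.length = d1.2 + d2.2 := by
    have := hvq.2
    rw [← hcm, List.length_map, hcp.length_eq] at this
    simp only [List.length_append, Nat.cast_add] at this
    rw [← this]; ring
  set N : ℕ → ZMod 2 := fun x => s1.count x + s2.count x +
    (Qr.map Prod.snd).flatten.count x with hN
  have hcnt : ∀ x ∈ P, x ≠ b → (E.count x : ZMod 2) + N x + (if x = a then N b else 0) =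
      if x = a then R a + R b else R x := by
    intro x hx hxb
    rw [← hc x (Finset.mem_erase.2 ⟨hxb, hx⟩)]
    have : (Q'.map Prod.snd).flatten = ((Qr.map Prod.snd).flatten).map
        (fun y => if y = b then a else y) := by
      rw [← r3, List.map_flatten]
    rw [List.map_cons, List.flatten_cons, this, ← hcm, List.count_append,
      count_map_if a b x hab _ hxb, count_map_if a b x hab _ hxb, hcp.count_eq, hcp.count_eq]
    have hEb : E.count b = 0 := by
      rcases hE' with rfl | rfl
      · simp
      · simp [hab]
    simp only [List.count_append, hEb, hN]
    split_ifs <;> push_cast <;> ring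
  have hE1 : ((E.length : ZMod 2) = 1 → a ∈ E ) := by
    rcases hE' with rfl | rfl <;> simp
  have hEa : (E.count a : ZMod 2) = E.length := by
    rcases hE' with rfl | rfl <;> simp
  have hconn : ∀ (g : ℕ → ZMod 2) (k : ZMod 2) (K : List (List ℕ × ZMod 2)),
      K.map Prod.fst = Qr.map Prod.snd → g a = g b → ((E.length : ZMod 2) = 1 → g a = k) →
      (∀ u ∈ s1, g u = k) →
      (∀ u ∈ s2, g u = k) → (∀ k ∈ K, ∀ u ∈ k.1, g u = k.2) →
      ∃ t, (∀ u ∈ P, g u = t) ∧ k = t ∧ ∀ k ∈ K, k.2 = t := by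
    intro g k K hK hgab hg1 hgs1 hgs2 hgK
    have hgf : ∀ v, g (if v = b then a else v) = g v := by
      intro v; split_ifs with hv
      · rw [hv, hgab]
      · rfl
    obtain ⟨t, t1, t2⟩ := hco g ((q.2, k) :: K.map
      (fun k => (k.1.map (fun y => if y = b then a else y), k.2)))
      (by
        rw [List.map_cons, List.map_cons, ← r3, ← hK]
        simp [Function.comp_def])
      (by
        intro κ hκ u hu
        rcases List.mem_cons.1 hκ with rfl | hκ
        · simp only at hu ⊢
          rw [← hcm] at hu
          obtain ⟨v, hv, rfl⟩ := List.mem_map.1 hu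
          rw [hgf]
          have hv := hcp.mem_iff.1 hv
          rw [List.mem_append, List.mem_append] at hv
          rcases hv with hv | hv | hv
          · rcases hE' with rfl | rfl
            · simp at hv
            · rw [List.mem_singleton.1 hv]; exact hg1 (by simp)
          · exact hgs1 v hv
          · exact hgs2 v hv
        · obtain ⟨κ0, hκ0, rfl⟩ := List.mem_map.1 hκ
          obtain ⟨v, hv, rfl⟩ := List.mem_map.1 hu
          rw [hgf]
          exact hgK κ0 hκ0 v hv)
    refine ⟨t, ?_, t2 (q.2, k) (by simp), ?_⟩
    · intro u hu
      by_cases hub : u = b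
      · rw [hub, ← hgab]; exact t1 a (Finset.mem_erase.2 ⟨hab, haP⟩)
      · exact t1 u (Finset.mem_erase.2 ⟨hub, hu⟩)
    · intro κ hκ
      exact t2 (κ.1.map (fun y => if y = b then a else y), κ.2)
        (List.mem_cons_of_mem _ (List.mem_map.2 ⟨κ, hκ, rfl⟩))
  have hna := hcnt a haP hab
  rw [if_pos rfl, if_pos rfl] at hna
  obtain ⟨D1, D2, m1, m2, m3, m4, m5, m6, m7⟩ := core hab haP hbP s1 s2 (Qr.map Prod.snd)
    (E.length : ZMod 2) hconn (d1.2 + s1.length) (d2.2 + s2.length) (R a + N a) (R b + N b)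
    (by
      have : d1.2 + s1.length + (d2.2 + s2.length) = (d1.2 + d2.2) + s1.length + s2.length := by
        ring
      rw [this, ← hlen]
      have e : (E.length : ZMod 2) + s1.length + s2.length + s1.length + s2.length =
        E.length + ((s1.length : ZMod 2) + s1.length) + (s2.length + s2.length) := by ring
      rw [e, z2add, z2add]; ring)
    (by
      have : R a + N a + (R b + N b) = (R a + R b) + N a + N b := by ring
      rw [this, ← hna, hEa]
      have e : (E.length : ZMod 2) + N a + N b + N a + N b = E.length + (N a + N a) + (N b + N b) := by
        ring
      rw [e, z2add, z2add]; ring)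
  refine ⟨(d1, D1 ++ s1) :: (d2, D2 ++ s2) :: Qr, by simp [r1], ?_, ?_, by simpa using m7⟩
  · intro q' hq'
    simp only [List.mem_cons] at hq'
    rcases hq' with rfl | rfl | hq'
    · constructor
      · simp only [e1]
        exact (m1.subperm.append hs1 : (D1 ++ s1).Subperm ([a, b] ++ l1))
      · simp only [List.length_append, Nat.cast_add, m3]
        rw [add_assoc, z2add, add_zero]
    · constructor
      · simp only [e2]
        exact (m2.subperm.append hs2 : (D2 ++ s2).Subperm ([a, b] ++ l2))
      · simp only [List.length_append, Nat.cast_add, m4]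
        rw [add_assoc, z2add, add_zero]
    · exact r2 q' hq'
  · intro x hx
    have e : (((((d1, D1 ++ s1) :: (d2, D2 ++ s2) :: Qr).map Prod.snd).flatten.count x : ℕ) : ZMod 2)
        = ((D1 ++ D2).count x : ℕ) + N x := by
      simp only [List.map_cons, List.flatten_cons, List.count_append, hN]
      push_cast
      ring
    rw [e]
    by_cases hxa : x = a
    · rw [hxa, m5, add_assoc, z2add, add_zero]
    · by_cases hxb : x = b
      · rw [hxb, m6, add_assoc, z2add, add_zero]
      · have h0 : ∀ D0 : List ℕ, D0.Sublist [a, b] → D0.count x = 0 := by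
          intro D0 h0
          apply List.count_eq_zero.2
          intro hx0
          have := h0.subset hx0
          simp [hxa, hxb] at this
        have hEx : E.count x = 0 := by
          rcases hE' with rfl | rfl
          · simp
          · simp [Ne.symm hxa]
        have := hcnt x hx hxb
        rw [if_neg hxa, if_neg hxa, hEx] at this
        rw [List.count_append, h0 D1 m1, h0 D2 m2, ← this]
        simp

theorem tri_choice (a b : ℕ) (hab : a ≠ b) (u z : ZMod 2) :
    ∃ l : List ℕ, l.Subperm [a, b, b] ∧ (l.length : ZMod 2) = z ∧ (l.count a : ZMod 2) = u ∧
      (l.count b : ZMod 2) = u + z ∧ (∀ x, x ≠ a → x ≠ b → l.count x = 0) ∧ b ∈ l ∧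
      (u = 1 → a ∈ l) := by
  have hba := hab.symm
  have two' : (2 : ZMod 2) = 0 := rfl
  have three' : (3 : ZMod 2) = 1 := rfl
  rcases z2cases u with rfl | rfl <;> rcases z2cases z with rfl | rfl
  · refine ⟨[b, b], List.Sublist.subperm (by simp), by simp [two'], by simp [hba],
      by simp [two'], ?_, by simp, by simp⟩
    intro x h1 h2; simp [Ne.symm h2]
  · refine ⟨[b], List.Sublist.subperm (by simp), by simp, by simp [hba],
      by simp, ?_, by simp, by simp⟩
    intro x h1 h2; simp [Ne.symm h2]
  · refine ⟨[a, b], List.Sublist.subperm (by simp), by simp [two'], by simp [hba],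
      by simp [hab], ?_, by simp, by simp⟩
    intro x h1 h2; simp [Ne.symm h2, Ne.symm h1]
  · refine ⟨[a, b, b], List.Subperm.refl _, by simp [three'], by simp [hba],
      by simp [hab, z2add, two'], ?_, by simp, by simp⟩
    intro x h1 h2; simp [Ne.symm h2, Ne.symm h1]

theorem tri_aux : ∀ A B C : ZMod 2, A + B + C = 0 → (A = 0 ∧ B = 0 ∧ C = 0) ∨
    (A = 1 ∧ B = 0 ∧ C = 1) ∨ (A = 1 ∧ B = 1 ∧ C = 0) ∨ (A = 0 ∧ B = 1 ∧ C = 1) := by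
  decide

theorem tri_flags : ∀ A B C : ZMod 2, A + B + C = 0 → ∃ u1 u2 u3 : ZMod 2,
    u1 + u3 = A ∧ u1 + u2 = B ∧ u2 + u3 = C ∧
    ((u1 = 1 ∧ u2 = 1) ∨ (u1 = 1 ∧ u3 = 1) ∨ (u2 = 1 ∧ u3 = 1)) := by
  intro A B C h
  have two' : (1 + 1 : ZMod 2) = 0 := rfl
  rcases tri_aux A B C h with ⟨rfl, rfl, rfl⟩ | ⟨rfl, rfl, rfl⟩ | ⟨rfl, rfl, rfl⟩ | ⟨rfl, rfl, rfl⟩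
  · exact ⟨1, 1, 1, two', two', two', by simp⟩
  · exact ⟨1, 1, 0, by simp, two', by simp, by simp⟩
  · exact ⟨0, 1, 1, by simp, by simp, two', by simp⟩
  · exact ⟨1, 0, 1, two', by simp, by simp, by simp⟩

theorem tri_z : ∀ x y z a b c : ZMod 2, a + b + c = x + y + z → (a + z) + (b + x) + (c + y) = 0 := by
  decide

theorem tri_z2 : ∀ u v z r : ZMod 2, u + v = r + z → u + v + z = r := by
  decide

/-- the triangle with pendant doubled edges -/
theorem Coll.tri (a b c : ℕ) (hab : a ≠ b) (hbc : b ≠ c) (hca : c ≠ a) :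
    Coll {a, b, c} [[a, b, b], [b, c, c], [c, a, a]] := by
  intro D R hD hs
  have hl := congrArg List.length hD
  simp only [List.length_map, List.length_cons, List.length_nil] at hl
  obtain ⟨d1, d2, d3, rfl⟩ := List.length_eq_three.1 hl
  simp only [List.map_cons, List.map_nil, List.cons.injEq, and_true] at hD
  obtain ⟨e1, e2, e3⟩ := hD
  have hs' : R a + R b + R c = d1.2 + d2.2 + d3.2 := by
    rw [Finset.sum_insert (by simp [hab, hca.symm]), Finset.sum_insert (by simp [hbc]),
      Finset.sum_singleton] at hs
    simp only [List.map_cons, List.map_nil, List.sum_cons, List.sum_nil] at hs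
    rw [add_assoc, hs]; ring
  obtain ⟨u1, u2, u3, f1, f2, f3, f4⟩ := tri_flags (R a + d3.2) (R b + d1.2) (R c + d2.2)
    (tri_z _ _ _ _ _ _ hs')
  obtain ⟨l1, a1, a2, a3, a4, a5, a6, a7⟩ := tri_choice a b hab u1 d1.2
  obtain ⟨l2, b1, b2, b3, b4, b5, b6, b7⟩ := tri_choice b c hbc u2 d2.2
  obtain ⟨l3, c1, c2, c3, c4, c5, c6, c7⟩ := tri_choice c a hca u3 d3.2
  refine ⟨[(d1, l1), (d2, l2), (d3, l3)], by simp, ?_, ?_, ?_⟩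
  · intro q hq
    simp only [List.mem_cons, List.not_mem_nil, or_false] at hq
    rcases hq with rfl | rfl | rfl
    · exact ⟨by simpa only [e1] using a1, a2⟩
    · exact ⟨by simpa only [e2] using b1, b2⟩
    · exact ⟨by simpa only [e3] using c1, c2⟩
  · intro x hx
    simp only [List.map_cons, List.map_nil, List.flatten_cons, List.flatten_nil,
      List.append_nil, List.count_append, Nat.cast_add]
    simp only [Finset.mem_insert, Finset.mem_singleton] at hx
    rcases hx with rfl | rfl | rfl
    · rw [a3, b5 x hab hca.symm, c4]
      rw [← tri_z2 _ _ _ _ f1]; push_cast; ring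
    · rw [a4, b3, c5 x hbc hab.symm]
      rw [← tri_z2 _ _ _ _ f2]; push_cast; ring
    · rw [a5 x hca hbc.symm, b4, c3]
      rw [← tri_z2 _ _ _ _ f3]; push_cast; ring
  · intro g K hK hg
    have hl := congrArg List.length hK
    simp only [List.length_map, List.length_cons, List.length_nil] at hl
    obtain ⟨k1, k2, k3, rfl⟩ := List.length_eq_three.1 hl
    simp only [List.map_cons, List.map_nil, List.cons.injEq, and_true] at hK
    obtain ⟨h1, h2, h3⟩ := hK
    have g1 := hg k1 (by simp)
    have g2 := hg k2 (by simp)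
    have g3 := hg k3 (by simp)
    rw [h1] at g1; rw [h2] at g2; rw [h3] at g3
    have i1 := g1 b a6
    have i2 := g2 c b6
    have i3 := g3 a c6
    have : k1.2 = k3.2 ∧ k2.2 = k3.2 := by
      rcases f4 with ⟨x, y⟩ | ⟨x, y⟩ | ⟨x, y⟩
      · have j1 := g1 a (a7 x); have j2 := g2 b (b7 y)
        exact ⟨by rw [← j1, i3], by rw [← j2, i1, ← j1, i3]⟩
      · have j1 := g1 a (a7 x); have j2 := g3 c (c7 y)
        exact ⟨by rw [← j1, i3], by rw [← j2, i2]⟩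
      · have j1 := g2 b (b7 x); have j2 := g3 c (c7 y)
        exact ⟨by rw [← i1, j1, ← i2, j2], by rw [← j2, i2]⟩
    refine ⟨k3.2, ?_, ?_⟩
    · intro u hu
      simp only [Finset.mem_insert, Finset.mem_singleton] at hu
      rcases hu with rfl | rfl | rfl
      · exact i3
      · rw [i1, this.1]
      · rw [i2, this.2]
    · intro k hk
      simp only [List.mem_cons, List.not_mem_nil, or_false] at hk
      rcases hk with rfl | rfl | rfl
      · exact this.1
      · exact this.2
      · rfl

noncomputable section

/-- conditional -/
@[reducible] def cnd {α : Type} (c : Bool) (x y : α) : α := @Bool.rec (fun _ => α) y x c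

/-- boolean membership -/
def memB (a : ℕ) (l : List ℕ) : Bool :=
  @List.rec ℕ (fun _ => Bool) false (fun x _ ih => cnd (Nat.beq x a) true ih) l

/-- remove one occurrence -/
def rmB (a : ℕ) (l : List ℕ) : List ℕ :=
  @List.rec ℕ (fun _ => List ℕ) [] (fun x l ih => cnd (Nat.beq x a) l (x :: ih)) l

/-- remove all occurrences -/
def rmAll (a : ℕ) (l : List ℕ) : List ℕ :=
  @List.rec ℕ (fun _ => List ℕ) [] (fun x _ ih => cnd (Nat.beq x a) ih (x :: ih)) l

/-- replace `b` by `a` -/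
def repB (a b : ℕ) (l : List ℕ) : List ℕ :=
  @List.rec ℕ (fun _ => List ℕ) [] (fun x _ ih => cnd (Nat.beq x b) (a :: ih) (x :: ih)) l

/-- append -/
def appB {α : Type} (l m : List α) : List α :=
  @List.rec α (fun _ => List α) m (fun x _ ih => x :: ih) l

/-- replace `b` by `a` everywhere -/
def repAll (a b : ℕ) (L : List (List ℕ)) : List (List ℕ) :=
  @List.rec (List ℕ) (fun _ => List (List ℕ)) [] (fun l _ ih => repB a b l :: ih) L

/-- all entries equal to `a` -/
def allB (a : ℕ) (l : List ℕ) : Bool :=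
  @List.rec ℕ (fun _ => Bool) true (fun x _ ih => cnd (Nat.beq x a) ih false) l

/-- length at least two -/
def len2 (l : List ℕ) : Bool :=
  @List.rec ℕ (fun _ => Bool) false (fun _ l _ =>
    @List.rec ℕ (fun _ => Bool) false (fun _ _ _ => true) l) l

/-- terminal test for one point -/
def oneB (a : ℕ) (L : List (List ℕ)) : Bool :=
  @List.rec (List ℕ) (fun _ => Bool) true
    (fun l _ ih => cnd (len2 l) (cnd (allB a l) ih false) false) L

/-- permutation test -/
def permB : List ℕ → List ℕ → Bool
  | [], [] => true
  | [], _ :: _ => false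
  | x :: l, m => cnd (memB x m) (permB l (rmB x m)) false

/-- oriented triangle test -/
def tri1 (a b c : ℕ) (e1 e2 e3 : List ℕ) : Bool :=
  permB [a, b, b] e1 && (permB [b, c, c] e2 && permB [c, a, a] e3)

/-- triangle test -/
def tri2 (a b c : ℕ) (e1 e2 e3 : List ℕ) : Bool :=
  tri1 a b c e1 e2 e3 || (tri1 a b c e1 e3 e2 || (tri1 a b c e2 e1 e3 ||
    (tri1 a b c e2 e3 e1 || (tri1 a b c e3 e1 e2 || tri1 a b c e3 e2 e1))))

/-- terminal triangle test -/
def triB : List ℕ → List (List ℕ) → Bool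
  | [a, b, c], [e1, e2, e3] =>
    cnd (Nat.beq a b) false (cnd (Nat.beq b c) false (cnd (Nat.beq c a) false
      (tri2 a b c e1 e2 e3 || tri2 a c b e1 e2 e3)))
  | _, _ => false

/-- evaluate a list -/
def frc (l : List ℕ) (k : List ℕ → Bool) : Bool :=
  @List.rec ℕ (fun _ => (List ℕ → Bool) → Bool) (fun k => k [])
    (fun x _ ih k => ih (fun l' => k (x :: l'))) l k

/-- evaluate a list of lists -/
def frcs (L : List (List ℕ)) (k : List (List ℕ) → Bool) : Bool :=
  @List.rec (List ℕ) (fun _ => (List (List ℕ) → Bool) → Bool) (fun k => k [])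
    (fun l _ ih k => frc l (fun l' => ih (fun L' => k (l' :: L')))) L k

/-- inner loop over the second shared point -/
def tryB (P : List ℕ) (F : List ℕ → List (List ℕ) → Bool) (e e' : List ℕ) (R : List (List ℕ))
    (a : ℕ) (l : List ℕ) : Bool :=
  @List.rec ℕ (fun _ => Bool) false (fun b _ ih => cnd (memB b e')
      (cnd (Nat.beq a b) ih
        (cnd (memB a P) (cnd (memB b P)
          (cnd (frc (rmAll b P) (fun P' => frcs (repB a b
              (a :: appB (rmB b (rmB a e)) (rmB b (rmB a e'))) :: repAll a b R) (fun L' => F P' L')))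
            true ih) false) false))
      ih) l

/-- loop over the first shared point -/
def tryA (P : List ℕ) (F : List ℕ → List (List ℕ) → Bool) (e e' : List ℕ) (R : List (List ℕ))
    (l : List ℕ) : Bool :=
  @List.rec ℕ (fun _ => Bool) false (fun a l ih =>
    cnd (memB a e') (cnd (tryB P F e e' R a l) true ih) ih) l

/-- loop over the second hyperedge -/
def try2 (P : List ℕ) (F : List ℕ → List (List ℕ) → Bool) (e : List ℕ)
    (M L : List (List ℕ)) : Bool :=
  @List.rec (List ℕ) (fun _ => List (List ℕ) → Bool) (fun _ => false)
    (fun e' L ih M => cnd (tryA P F e e' (appB M L) e) true (ih (e' :: M))) L M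

/-- loop over the first hyperedge -/
def try1 (P : List ℕ) (F : List ℕ → List (List ℕ) → Bool) (M L : List (List ℕ)) : Bool :=
  @List.rec (List ℕ) (fun _ => List (List ℕ) → Bool) (fun _ => false)
    (fun e L ih M => cnd (try2 P F e M L) true (ih (e :: M))) L M

/-- one-point test with fallback -/
def headB (P : List ℕ) (L : List (List ℕ)) (B : Bool) : Bool :=
  @List.rec ℕ (fun _ => Bool) false (fun a l _ =>
    @List.rec ℕ (fun _ => Bool) (oneB a L) (fun _ _ _ => B) l) P

/-- collapsing procedure -/
def collapse (n : ℕ) : List ℕ → List (List ℕ) → Bool :=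
  @Nat.rec (fun _ => List ℕ → List (List ℕ) → Bool) (fun P L => headB P L false)
    (fun _ ih P L => headB P L (cnd (try1 P ih [] L) true (triB P L))) n

/-- restrict a list to `S` -/
def resB (S : List ℕ) (l : List ℕ) : List ℕ :=
  @List.rec ℕ (fun _ => List ℕ) [] (fun x _ ih => cnd (memB x S) (x :: ih) ih) l

/-- restrict a system to `S` -/
def resAll (S : List ℕ) (L : List (List ℕ)) : List (List ℕ) :=
  @List.rec (List ℕ) (fun _ => List (List ℕ)) []
    (fun l _ ih => cnd (len2 (resB S l)) (resB S l :: ih) ih) L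

/-- collapsibility of the part inside `S` -/
def collS (S : List ℕ) (L : List (List ℕ)) : Bool :=
  frcs (resAll S L) (fun L1 => @List.rec (List ℕ) (fun _ => Bool) false
    (fun l L' _ => collapse (nat_lit 6) S (l :: L')) L1)

def six : List ℕ := [nat_lit 0, nat_lit 1, nat_lit 2, nat_lit 3, nat_lit 4, nat_lit 5]

/-- number of masks in `M` inside `S` at least `n` -/
def cntB (S : ℕ) (M : List ℕ) (n : ℕ) : Bool :=
  @List.rec ℕ (fun _ => ℕ → Bool) (fun n => Nat.beq n (nat_lit 0))
    (fun m _ ih n => cnd (Nat.beq (Nat.land m S) m) (ih (Nat.pred n)) (ih n)) M n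

/-- gated test over a table of point sets -/
def gateB (n m : ℕ) (M : List ℕ) (L : List (List ℕ)) (T : List (ℕ × List ℕ)) : Bool :=
  @List.rec (ℕ × List ℕ) (fun _ => Bool) false
    (fun x _ ih => @Prod.rec ℕ (List ℕ) (fun _ => Bool) (fun S s =>
      cnd (Nat.beq (Nat.land m S) m) (cnd (cntB S M n) (cnd (collS s L) true ih) ih) ih) x) T

/-- gated test on a repeated triple meeting the new triple in two points -/
def gateDup (t : List ℕ) (M : List ℕ) (L : List (List ℕ)) (L' : List (List ℕ)) (M' : List ℕ) : Bool :=
  @List.rec (List ℕ) (fun _ => List ℕ → Bool) (fun _ => false)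
    (fun s _ ih M' => @List.rec ℕ (fun _ => Bool) false (fun S N _ =>
      cnd (cntB S M (nat_lit 2)) (cnd (len2 (resB t s)) (cnd (collS s L) true (ih N)) (ih N)) (ih N))
      M') L' M'

def T20 : List (ℕ × List ℕ) :=
  [(nat_lit 7, [nat_lit 0, nat_lit 1, nat_lit 2]),
   (nat_lit 11, [nat_lit 0, nat_lit 1, nat_lit 3]),
   (nat_lit 19, [nat_lit 0, nat_lit 1, nat_lit 4]),
   (nat_lit 35, [nat_lit 0, nat_lit 1, nat_lit 5]),
   (nat_lit 13, [nat_lit 0, nat_lit 2, nat_lit 3]),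
   (nat_lit 21, [nat_lit 0, nat_lit 2, nat_lit 4]),
   (nat_lit 37, [nat_lit 0, nat_lit 2, nat_lit 5]),
   (nat_lit 25, [nat_lit 0, nat_lit 3, nat_lit 4]),
   (nat_lit 41, [nat_lit 0, nat_lit 3, nat_lit 5]),
   (nat_lit 49, [nat_lit 0, nat_lit 4, nat_lit 5]),
   (nat_lit 14, [nat_lit 1, nat_lit 2, nat_lit 3]),
   (nat_lit 22, [nat_lit 1, nat_lit 2, nat_lit 4]),
   (nat_lit 38, [nat_lit 1, nat_lit 2, nat_lit 5]),
   (nat_lit 26, [nat_lit 1, nat_lit 3, nat_lit 4]),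
   (nat_lit 42, [nat_lit 1, nat_lit 3, nat_lit 5]),
   (nat_lit 50, [nat_lit 1, nat_lit 4, nat_lit 5]),
   (nat_lit 28, [nat_lit 2, nat_lit 3, nat_lit 4]),
   (nat_lit 44, [nat_lit 2, nat_lit 3, nat_lit 5]),
   (nat_lit 52, [nat_lit 2, nat_lit 4, nat_lit 5]),
   (nat_lit 56, [nat_lit 3, nat_lit 4, nat_lit 5])]

/-- table of quadruples -/
def T15 : List (ℕ × List ℕ) :=
  [(nat_lit 15, [nat_lit 0, nat_lit 1, nat_lit 2, nat_lit 3]),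
   (nat_lit 23, [nat_lit 0, nat_lit 1, nat_lit 2, nat_lit 4]),
   (nat_lit 39, [nat_lit 0, nat_lit 1, nat_lit 2, nat_lit 5]),
   (nat_lit 27, [nat_lit 0, nat_lit 1, nat_lit 3, nat_lit 4]),
   (nat_lit 43, [nat_lit 0, nat_lit 1, nat_lit 3, nat_lit 5]),
   (nat_lit 51, [nat_lit 0, nat_lit 1, nat_lit 4, nat_lit 5]),
   (nat_lit 29, [nat_lit 0, nat_lit 2, nat_lit 3, nat_lit 4]),
   (nat_lit 45, [nat_lit 0, nat_lit 2, nat_lit 3, nat_lit 5]),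
   (nat_lit 53, [nat_lit 0, nat_lit 2, nat_lit 4, nat_lit 5]),
   (nat_lit 57, [nat_lit 0, nat_lit 3, nat_lit 4, nat_lit 5]),
   (nat_lit 30, [nat_lit 1, nat_lit 2, nat_lit 3, nat_lit 4]),
   (nat_lit 46, [nat_lit 1, nat_lit 2, nat_lit 3, nat_lit 5]),
   (nat_lit 54, [nat_lit 1, nat_lit 2, nat_lit 4, nat_lit 5]),
   (nat_lit 58, [nat_lit 1, nat_lit 3, nat_lit 4, nat_lit 5]),
   (nat_lit 60, [nat_lit 2, nat_lit 3, nat_lit 4, nat_lit 5])]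

/-- table of quintuples -/
def T6 : List (ℕ × List ℕ) :=
  [(nat_lit 31, [nat_lit 0, nat_lit 1, nat_lit 2, nat_lit 3, nat_lit 4]),
   (nat_lit 47, [nat_lit 0, nat_lit 1, nat_lit 2, nat_lit 3, nat_lit 5]),
   (nat_lit 55, [nat_lit 0, nat_lit 1, nat_lit 2, nat_lit 4, nat_lit 5]),
   (nat_lit 59, [nat_lit 0, nat_lit 1, nat_lit 3, nat_lit 4, nat_lit 5]),
   (nat_lit 61, [nat_lit 0, nat_lit 2, nat_lit 3, nat_lit 4, nat_lit 5]),
   (nat_lit 62, [nat_lit 1, nat_lit 2, nat_lit 3, nat_lit 4, nat_lit 5])]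

/-- pruning test -/
def prune (m : ℕ) (t : List ℕ) (M : List ℕ) (L : List (List ℕ)) : Bool :=
  cnd (cnd (cntB m M (nat_lit 2)) (collS t L) false) true (cnd (gateDup t M L L M) true
    (cnd (gateB (nat_lit 4) m M L T15) true (gateB (nat_lit 5) m M L T6)))

/-- inner loop of the search -/
def goB (F : List (ℕ × List ℕ) → List ℕ → List (List ℕ) → Bool) (M : List ℕ) (acc : List (List ℕ))
    (av : List (ℕ × List ℕ)) : Bool :=
  @List.rec (ℕ × List ℕ) (fun _ => Bool) true
    (fun x r ih => @Prod.rec ℕ (List ℕ) (fun _ => Bool) (fun m t =>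
      cnd (cnd (prune m t (m :: M) (t :: acc)) true (F (x :: r) (m :: M) (t :: acc))) ih false) x) av

/-- exhaustive search -/
def dfsB (n : ℕ) : List (ℕ × List ℕ) → List ℕ → List (List ℕ) → Bool :=
  @Nat.rec (fun _ => List (ℕ × List ℕ) → List ℕ → List (List ℕ) → Bool)
    (fun _ _ acc => collS six acc)
    (fun _ ih av M acc => goB ih M acc av) n

end

theorem beq_cases (x a : ℕ) : (Nat.beq x a = true ∧ x = a) ∨ (Nat.beq x a = false ∧ x ≠ a) := by
  by_cases h : x = a
  · left; exact ⟨by rw [h]; exact Nat.beq_refl a, h⟩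
  · right; exact ⟨by
      cases hb : Nat.beq x a
      · rfl
      · exact (h (Nat.eq_of_beq_eq_true hb)).elim, h⟩

theorem cnd_or {c d : Bool} (h : cnd c true d = true) : c = true ∨ d = true := by
  cases c
  · right; exact h
  · left; rfl

theorem cnd_and {c d : Bool} (h : cnd c d false = true) : c = true ∧ d = true := by
  cases c
  · exact (Bool.false_ne_true h).elim
  · exact ⟨rfl, h⟩

theorem memB_iff (a : ℕ) (l : List ℕ) : memB a l = true ↔ a ∈ l := by
  induction l with
  | nil => exact ⟨fun h => (Bool.false_ne_true h).elim, fun h => by simp at h⟩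
  | cons x l ih =>
    change cnd (Nat.beq x a) true (memB a l) = true ↔ _
    rcases beq_cases x a with ⟨h, h'⟩ | ⟨h, h'⟩ <;> rw [h]
    · simp [h']
    · change memB a l = true ↔ _
      rw [ih]; simp [Ne.symm h']

theorem rmB_perm (a : ℕ) (l : List ℕ) (h : a ∈ l) : l.Perm (a :: rmB a l) := by
  induction l with
  | nil => simp at h
  | cons x l ih =>
    have e : rmB a (x :: l) = cnd (Nat.beq x a) l (x :: rmB a l) := rfl
    rw [e]
    rcases beq_cases x a with ⟨h1, h'⟩ | ⟨h1, h'⟩ <;> rw [h1]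
    · rw [h']
    · have : a ∈ l := by simpa [Ne.symm h'] using h
      exact ((ih this).cons x).trans (List.Perm.swap _ _ _)

theorem rmB_mem (a b : ℕ) (hab : a ≠ b) (l : List ℕ) (h : b ∈ l) : b ∈ rmB a l := by
  by_cases ha : a ∈ l
  · have := (rmB_perm a l ha).mem_iff.1 h
    simpa [Ne.symm hab] using this
  · have : rmB a l = l := by
      clear h
      induction l with
      | nil => rfl
      | cons x l ih =>
        have e : rmB a (x :: l) = cnd (Nat.beq x a) l (x :: rmB a l) := rfl
        rw [e]
        rcases beq_cases x a with ⟨h1, h'⟩ | ⟨h1, h'⟩ <;> rw [h1]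
        · simp [h'] at ha
        · change x :: rmB a l = _
          rw [ih (by simp at ha; tauto)]
    rw [this]; exact h

theorem rmAll_mem (b x : ℕ) (l : List ℕ) : x ∈ rmAll b l ↔ x ∈ l ∧ x ≠ b := by
  induction l with
  | nil => simp [rmAll]
  | cons y l ih =>
    have e : rmAll b (y :: l) = cnd (Nat.beq y b) (rmAll b l) (y :: rmAll b l) := rfl
    rw [e]
    rcases beq_cases y b with ⟨h1, h'⟩ | ⟨h1, h'⟩ <;> rw [h1]
    · change x ∈ rmAll b l ↔ _
      rw [ih, h']; simp; tauto
    · change x ∈ y :: rmAll b l ↔ _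
      rw [List.mem_cons, ih, List.mem_cons]
      constructor
      · rintro (rfl | h)
        · exact ⟨Or.inl rfl, h'⟩
        · exact ⟨Or.inr h.1, h.2⟩
      · rintro ⟨rfl | h, h2⟩
        · exact Or.inl rfl
        · exact Or.inr ⟨h, h2⟩

theorem rmAll_toFinset (b : ℕ) (P : List ℕ) : (rmAll b P).toFinset = P.toFinset.erase b := by
  ext x
  simp only [List.mem_toFinset, Finset.mem_erase, rmAll_mem]
  tauto

theorem repB_eq (a b : ℕ) (l : List ℕ) :
    repB a b l = l.map (fun y => if y = b then a else y) := by
  induction l with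
  | nil => rfl
  | cons x l ih =>
    have e : repB a b (x :: l) = cnd (Nat.beq x b) (a :: repB a b l) (x :: repB a b l) := rfl
    rw [e, ih]
    rcases beq_cases x b with ⟨h1, h'⟩ | ⟨h1, h'⟩ <;> rw [h1]
    · simp [h']
    · simp [h']

theorem appB_eq {α : Type} (l m : List α) : appB l m = l ++ m := by
  induction l with
  | nil => rfl
  | cons x l ih =>
    have e : appB (x :: l) m = x :: appB l m := rfl
    rw [e, ih]; rfl

theorem repAll_eq (a b : ℕ) (L : List (List ℕ)) :
    repAll a b L = L.map (List.map (fun y => if y = b then a else y)) := by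
  induction L with
  | nil => rfl
  | cons x l ih =>
    have e : repAll a b (x :: l) = repB a b x :: repAll a b l := rfl
    rw [e, ih, repB_eq]; rfl

theorem allB_sound (a : ℕ) (l : List ℕ) (h : allB a l = true) : ∀ x ∈ l, x = a := by
  induction l with
  | nil => simp
  | cons x l ih =>
    have e : allB a (x :: l) = cnd (Nat.beq x a) (allB a l) false := rfl
    rw [e] at h
    obtain ⟨h1, h2⟩ := cnd_and h
    intro y hy
    rcases List.mem_cons.1 hy with rfl | hy
    · exact Nat.eq_of_beq_eq_true h1
    · exact ih h2 y hy

theorem len2_sound (l : List ℕ) (h : len2 l = true) : 2 ≤ l.length := by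
  match l, h with
  | [], h => exact (Bool.false_ne_true h).elim
  | [_], h => exact (Bool.false_ne_true h).elim
  | _ :: _ :: l, _ => simp

theorem oneB_sound (a : ℕ) (L : List (List ℕ)) (h : oneB a L = true) :
    ∀ e ∈ L, 2 ≤ e.length ∧ ∀ x ∈ e, x = a := by
  induction L with
  | nil => simp
  | cons l L ih =>
    have e : oneB a (l :: L) = cnd (len2 l) (cnd (allB a l) (oneB a L) false) false := rfl
    rw [e] at h
    obtain ⟨h1, h2⟩ := cnd_and h
    obtain ⟨h2, h3⟩ := cnd_and h2
    intro y hy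
    rcases List.mem_cons.1 hy with rfl | hy
    · exact ⟨len2_sound _ h1, allB_sound _ _ h2⟩
    · exact ih h3 y hy

theorem permB_sound : ∀ (l m : List ℕ), permB l m = true → l.Perm m := by
  intro l
  induction l with
  | nil =>
    intro m h
    match m, h with
    | [], _ => exact List.Perm.refl _
    | x :: m, h => simp [permB] at h
  | cons x l ih =>
    intro m h
    rw [permB] at h
    obtain ⟨h1, h2⟩ := cnd_and h
    exact ((ih _ h2).cons x).trans (rmB_perm x m ((memB_iff _ _).1 h1)).symm

theorem Coll.perm3 {P : Finset ℕ} {a b c a' b' c' : List ℕ} (h : Coll P [a, b, c])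
    (ha : a.Perm a') (hb : b.Perm b') (hc : c.Perm c') : Coll P [a', b', c'] := by
  have h1 := (h.perm_head ha).perm (L' := [b, c, a']) (List.perm_append_comm (l₁ := [a']) (l₂ := [b, c]))
  have h2 := (h1.perm_head hb).perm (L' := [c, a', b'])
    (List.perm_append_comm (l₁ := [b']) (l₂ := [c, a']))
  exact (h2.perm_head hc).perm (List.perm_append_comm (l₁ := [c']) (l₂ := [a', b']))

theorem tri1_sound {a b c : ℕ} (hab : a ≠ b) (hbc : b ≠ c) (hca : c ≠ a) {e1 e2 e3 : List ℕ}
    (h : tri1 a b c e1 e2 e3 = true) : Coll {a, b, c} [e1, e2, e3] := by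
  simp only [tri1, Bool.and_eq_true] at h
  exact (Coll.tri a b c hab hbc hca).perm3 (permB_sound _ _ h.1) (permB_sound _ _ h.2.1)
    (permB_sound _ _ h.2.2)

theorem tri2_sound {a b c : ℕ} (hab : a ≠ b) (hbc : b ≠ c) (hca : c ≠ a) {e1 e2 e3 : List ℕ}
    (h : tri2 a b c e1 e2 e3 = true) : Coll {a, b, c} [e1, e2, e3] := by
  simp only [tri2, Bool.or_eq_true] at h
  rcases h with h | h | h | h | h | h <;>
  · refine (tri1_sound hab hbc hca h).perm ?_
    first
      | exact List.Perm.refl _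
      | (rw [← Multiset.coe_eq_coe]
         simp only [← Multiset.cons_coe]
         ext x
         simp only [Multiset.count_cons]
         ring)

theorem triB_sound : ∀ (P : List ℕ) (L : List (List ℕ)), triB P L = true →
    Coll P.toFinset L := by
  intro P L h
  unfold triB at h
  split at h
  · rename_i a b c e1 e2 e3
    rcases beq_cases a b with ⟨h1, h'⟩ | ⟨h1, h'⟩ <;> rw [h1] at h
    · exact (Bool.false_ne_true h).elim
    rcases beq_cases b c with ⟨h2, h2'⟩ | ⟨h2, h2'⟩ <;> rw [h2] at h
    · exact (Bool.false_ne_true h).elim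
    rcases beq_cases c a with ⟨h3, h3'⟩ | ⟨h3, h3'⟩ <;> rw [h3] at h
    · exact (Bool.false_ne_true h).elim
    have hP : [a, b, c].toFinset = {a, b, c} := by simp
    rw [hP]
    rcases (Bool.or_eq_true _ _).mp h with h | h
    · exact tri2_sound h' h2' h3' h
    · have := tri2_sound h3'.symm h2'.symm h'.symm h
      rwa [Finset.pair_comm c b] at this
  · exact (Bool.false_ne_true h).elim

theorem frc_eq (l : List ℕ) : ∀ k : List ℕ → Bool, frc l k = k l := by
  induction l with
  | nil => intro k; rfl
  | cons x l ih =>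
    intro k
    exact ih (fun l' => k (x :: l'))

theorem frcs_eq (L : List (List ℕ)) : ∀ k : List (List ℕ) → Bool, frcs L k = k L := by
  induction L with
  | nil => intro k; rfl
  | cons l L ih =>
    intro k
    have e : frcs (l :: L) k = frc l (fun l' => frcs L (fun L' => k (l' :: L'))) := rfl
    rw [e, frc_eq, ih]

theorem perm_ab {a b : ℕ} (hab : a ≠ b) {e : List ℕ} (ha : a ∈ e) (hb : b ∈ e) :
    (a :: b :: rmB b (rmB a e)).Perm e :=
  (((rmB_perm b _ (rmB_mem a b hab e hb)).symm).cons a).trans (rmB_perm a e ha).symm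

theorem tryB_sound {P : List ℕ} {F : List ℕ → List (List ℕ) → Bool}
    (HF : ∀ P' L', F P' L' = true → Coll P'.toFinset L') {e e' : List ℕ} {R : List (List ℕ)}
    {a : ℕ} (hae : a ∈ e) (hae' : a ∈ e') : ∀ l : List ℕ, (∀ x ∈ l, x ∈ e) →
    tryB P F e e' R a l = true → Coll P.toFinset (e :: e' :: R) := by
  intro l
  induction l with
  | nil => intro _ h; exact (Bool.false_ne_true h).elim
  | cons b l ih =>
    intro hl h
    have ih := ih (fun x hx => hl x (by simp [hx]))
    have eq : tryB P F e e' R a (b :: l) = cnd (memB b e')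
      (cnd (Nat.beq a b) (tryB P F e e' R a l)
        (cnd (memB a P) (cnd (memB b P)
          (cnd (frc (rmAll b P) (fun P' => frcs (repB a b
              (a :: appB (rmB b (rmB a e)) (rmB b (rmB a e'))) :: repAll a b R) (fun L' => F P' L')))
            true (tryB P F e e' R a l)) false) false))
      (tryB P F e e' R a l) := rfl
    rw [eq] at h
    cases hb : memB b e' with
    | false => rw [hb] at h; exact ih h
    | true =>
      rw [hb] at h
      rcases beq_cases a b with ⟨h1, h'⟩ | ⟨h1, h'⟩ <;> rw [h1] at h
      · exact ih h
      · obtain ⟨ha, h⟩ := cnd_and h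
        obtain ⟨hbP, h⟩ := cnd_and h
        rcases cnd_or h with h | h
        · rw [frc_eq, frcs_eq] at h
          have hc := HF _ _ h
          rw [rmAll_toFinset, repB_eq, repAll_eq, appB_eq] at hc
          have hbe := hl b (by simp)
          have hbe' := (memB_iff _ _).1 hb
          have := Coll.pi h' (by simpa using (memB_iff _ _).1 ha)
            (by simpa using (memB_iff _ _).1 hbP) _ _ _ hc
          have := (this.perm_head (perm_ab h' hae hbe)).perm (List.Perm.swap _ _ _)
          exact (this.perm_head (perm_ab h' hae' hbe')).perm (List.Perm.swap _ _ _)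
        · exact ih h

theorem tryA_sound {P : List ℕ} {F : List ℕ → List (List ℕ) → Bool}
    (HF : ∀ P' L', F P' L' = true → Coll P'.toFinset L') {e e' : List ℕ} {R : List (List ℕ)} :
    ∀ l : List ℕ, (∀ x ∈ l, x ∈ e) →
    tryA P F e e' R l = true → Coll P.toFinset (e :: e' :: R) := by
  intro l
  induction l with
  | nil => intro _ h; exact (Bool.false_ne_true h).elim
  | cons a l ih =>
    intro hl h
    have ih := ih (fun x hx => hl x (by simp [hx]))
    have eq : tryA P F e e' R (a :: l) =
      cnd (memB a e') (cnd (tryB P F e e' R a l) true (tryA P F e e' R l)) (tryA P F e e' R l) := rfl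
    rw [eq] at h
    cases hb : memB a e' with
    | false => rw [hb] at h; exact ih h
    | true =>
      rw [hb] at h
      rcases cnd_or h with h | h
      · exact tryB_sound HF (hl a (by simp)) ((memB_iff _ _).1 hb) l
          (fun x hx => hl x (by simp [hx])) h
      · exact ih h

theorem try2_sound {P : List ℕ} {F : List ℕ → List (List ℕ) → Bool}
    (HF : ∀ P' L', F P' L' = true → Coll P'.toFinset L') {e : List ℕ} :
    ∀ L M : List (List ℕ), try2 P F e M L = true → Coll P.toFinset (e :: (M ++ L)) := by
  intro L
  induction L with
  | nil => intro M h; exact (Bool.false_ne_true h).elim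
  | cons e' L ih =>
    intro M h
    rcases cnd_or (c := tryA P F e e' (appB M L) e) (d := try2 P F e (e' :: M) L) h with h | h
    · have := tryA_sound HF e (fun x hx => hx) h
      rw [appB_eq] at this
      exact this.perm (List.Perm.cons _ List.perm_middle.symm)
    · exact (ih _ h).perm (List.Perm.cons _ List.perm_middle.symm)

theorem try1_sound {P : List ℕ} {F : List ℕ → List (List ℕ) → Bool}
    (HF : ∀ P' L', F P' L' = true → Coll P'.toFinset L') :
    ∀ L M : List (List ℕ), try1 P F M L = true → Coll P.toFinset (M ++ L) := by
  intro L
  induction L with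
  | nil => intro M h; exact (Bool.false_ne_true h).elim
  | cons e L ih =>
    intro M h
    rcases cnd_or (c := try2 P F e M L) (d := try1 P F (e :: M) L) h with h | h
    · exact (try2_sound HF L M h).perm List.perm_middle.symm
    · exact (ih _ h).perm List.perm_middle.symm

theorem headB_sound {P : List ℕ} {L : List (List ℕ)} {B : Bool} (h : headB P L B = true) :
    P ≠ [] ∧ (Coll P.toFinset L ∨ B = true) := by
  match P, h with
  | [], h => exact (Bool.false_ne_true h).elim
  | [a], h =>
    refine ⟨by simp, Or.inl ?_⟩
    have := Coll.base a L (oneB_sound a L h)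
    simpa using this
  | _ :: _ :: _, h => exact ⟨by simp, Or.inr h⟩

theorem collapse_sound : ∀ (n : ℕ) (P : List ℕ) (L : List (List ℕ)), collapse n P L = true →
    P ≠ [] ∧ Coll P.toFinset L := by
  intro n
  induction n with
  | zero =>
    intro P L h
    obtain ⟨h1, h2⟩ := headB_sound h
    exact ⟨h1, h2.resolve_right Bool.false_ne_true⟩
  | succ n ih =>
    intro P L h
    obtain ⟨h1, h2⟩ := headB_sound (B := cnd (try1 P (collapse n) [] L) true (triB P L)) h
    refine ⟨h1, ?_⟩
    rcases h2 with h2 | h2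
    · exact h2
    · rcases cnd_or h2 with h2 | h2
      · exact try1_sound (fun P' L' h => (ih P' L' h).2) L [] h2
      · exact triB_sound P L h2

theorem resB_mem (S l : List ℕ) : ∀ x ∈ resB S l, x ∈ S := by
  induction l with
  | nil => intro x hx; simp [resB] at hx
  | cons y l ih =>
    intro x hx
    have e : resB S (y :: l) = cnd (memB y S) (y :: resB S l) (resB S l) := rfl
    rw [e] at hx
    cases hb : memB y S with
    | false => rw [hb] at hx; exact ih x hx
    | true =>
      rw [hb] at hx
      rcases List.mem_cons.1 hx with rfl | hx
      · exact (memB_iff _ _).1 hb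
      · exact ih x hx

theorem resB_sublist (S l : List ℕ) : (resB S l).Sublist l := by
  induction l with
  | nil => exact List.Sublist.refl _
  | cons y l ih =>
    have e : resB S (y :: l) = cnd (memB y S) (y :: resB S l) (resB S l) := rfl
    rw [e]
    cases memB y S with
    | false => exact ih.cons y
    | true => exact ih.cons_cons y

theorem resAll_eq (S : List ℕ) (L : List (List ℕ)) :
    ∃ M : List (List ℕ), M.Sublist L ∧ resAll S L = M.map (resB S) := by
  induction L with
  | nil => exact ⟨[], List.Sublist.refl _, rfl⟩
  | cons l L ih =>
    obtain ⟨M, h1, h2⟩ := ih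
    have e : resAll S (l :: L) = cnd (len2 (resB S l)) (resB S l :: resAll S L) (resAll S L) := rfl
    rw [e]
    cases len2 (resB S l) with
    | false => exact ⟨M, h1.cons l, h2⟩
    | true => exact ⟨l :: M, h1.cons_cons l, by
        change resB S l :: resAll S L = _
        rw [h2]; rfl⟩

/-- a system containing a collapsible part -/
def Bad (L : List (List ℕ)) : Prop :=
  ∃ (S : List ℕ) (M : List (List ℕ)), M.Subperm L ∧ S ≠ [] ∧ M ≠ [] ∧
    Coll S.toFinset (M.map (resB S))

theorem Bad.mono {L L' : List (List ℕ)} (h : Bad L) (hs : L.Subperm L') : Bad L' := by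
  obtain ⟨S, M, h1, h2⟩ := h
  exact ⟨S, M, h1.trans hs, h2⟩

theorem collS_sound {S : List ℕ} {L : List (List ℕ)} (h : collS S L = true) : Bad L := by
  unfold collS at h
  rw [frcs_eq] at h
  obtain ⟨M, h1, h2⟩ := resAll_eq S L
  rw [h2] at h
  match M, h1, h with
  | [], _, h => exact (Bool.false_ne_true h).elim
  | m :: M, h1, h =>
    obtain ⟨h3, h4⟩ := collapse_sound _ _ _ h
    exact ⟨S, m :: M, h1.subperm, h3, by simp, h4⟩

theorem gateB_sound {n m : ℕ} {M : List ℕ} {L : List (List ℕ)} :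
    ∀ T : List (ℕ × List ℕ), gateB n m M L T = true → Bad L := by
  intro T
  induction T with
  | nil => intro h; exact (Bool.false_ne_true h).elim
  | cons x T ih =>
    intro h
    obtain ⟨S, s⟩ := x
    have e : gateB n m M L ((S, s) :: T) = cnd (Nat.beq (Nat.land m S) m)
      (cnd (cntB S M n) (cnd (collS s L) true (gateB n m M L T)) (gateB n m M L T))
      (gateB n m M L T) := rfl
    rw [e] at h
    cases hb : Nat.beq (Nat.land m S) m with
    | false => rw [hb] at h; exact ih h
    | true =>
      rw [hb] at h
      cases hb : cntB S M n with
      | false => rw [hb] at h; exact ih h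
      | true =>
        rw [hb] at h
        rcases cnd_or h with h | h
        · exact collS_sound h
        · exact ih h

theorem gateDup_sound {t : List ℕ} {M : List ℕ} {L : List (List ℕ)} :
    ∀ (L' : List (List ℕ)) (M' : List ℕ), gateDup t M L L' M' = true → Bad L := by
  intro L'
  induction L' with
  | nil => intro M' h; exact (Bool.false_ne_true h).elim
  | cons s L' ih =>
    intro M' h
    match M', h with
    | [], h => exact (Bool.false_ne_true h).elim
    | S :: N, h =>
      have e : gateDup t M L (s :: L') (S :: N) = cnd (cntB S M 2)
        (cnd (len2 (resB t s)) (cnd (collS s L) true (gateDup t M L L' N)) (gateDup t M L L' N))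
        (gateDup t M L L' N) := rfl
      rw [e] at h
      cases hb : cntB S M 2 with
      | false => rw [hb] at h; exact ih N h
      | true =>
        rw [hb] at h
        cases hb : len2 (resB t s) with
        | false => rw [hb] at h; exact ih N h
        | true =>
          rw [hb] at h
          rcases cnd_or h with h | h
          · exact collS_sound h
          · exact ih N h

theorem prune_sound {m : ℕ} {t : List ℕ} {M : List ℕ} {L : List (List ℕ)}
    (h : prune m t M L = true) : Bad L := by
  unfold prune at h
  rcases cnd_or h with h | h
  · exact collS_sound (cnd_and h).2
  rcases cnd_or h with h | h
  · exact gateDup_sound _ _ h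
  rcases cnd_or h with h | h
  · exact gateB_sound _ h
  · exact gateB_sound _ h

theorem goB_sound {n : ℕ} {F : List (ℕ × List ℕ) → List ℕ → List (List ℕ) → Bool}
    (HF : ∀ av M acc, F av M acc = true → ∀ w : List (List ℕ), w.length = n →
      (∀ t ∈ w, t ∈ av.map Prod.snd) → Bad (w ++ acc)) (M : List ℕ) (acc : List (List ℕ)) :
    ∀ av : List (ℕ × List ℕ), goB F M acc av = true → ∀ w : List (List ℕ), w.length = n + 1 →
      (∀ t ∈ w, t ∈ av.map Prod.snd) → Bad (w ++ acc) := by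
  intro av
  induction av with
  | nil =>
    intro _ w hw hm
    match w, hw with
    | x :: w, _ => exact absurd (hm x (by simp)) (by simp)
  | cons x r ih =>
    intro h w hw hm
    obtain ⟨m, t⟩ := x
    have e : goB F M acc ((m, t) :: r) = cnd (cnd (prune m t (m :: M) (t :: acc)) true
      (F ((m, t) :: r) (m :: M) (t :: acc))) (goB F M acc r) false := rfl
    rw [e] at h
    obtain ⟨h1, h2⟩ := cnd_and h
    by_cases ht : t ∈ w
    · have hp := List.perm_cons_erase ht
      have hb : Bad (w.erase t ++ t :: acc) := by
        rcases cnd_or h1 with h1 | h1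
        · exact (prune_sound h1).mono (List.sublist_append_right _ _).subperm
        · refine HF _ _ _ h1 (w.erase t) ?_ ?_
          · rw [List.length_erase_of_mem ht, hw]; rfl
          · intro y hy
            exact hm y (List.mem_of_mem_erase hy)
      refine hb.mono (List.Perm.subperm ?_)
      exact List.perm_middle.trans (hp.symm.append_right acc)
    · refine ih h2 w hw (fun y hy => ?_)
      have := hm y hy
      simp only [List.map_cons, List.mem_cons] at this
      rcases this with rfl | this
      · exact (ht hy).elim
      · exact this

theorem dfsB_sound : ∀ (n : ℕ) (av : List (ℕ × List ℕ)) (M : List ℕ) (acc : List (List ℕ)),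
    dfsB n av M acc = true → ∀ w : List (List ℕ), w.length = n →
      (∀ t ∈ w, t ∈ av.map Prod.snd) → Bad (w ++ acc) := by
  intro n
  induction n with
  | zero =>
    intro av M acc h w hw _
    rw [List.length_eq_zero_iff.1 hw]
    exact collS_sound (S := six) h
  | succ n ih =>
    intro av M acc h
    exact goB_sound ih M acc av h

theorem dfs_one : dfsB 4 T20 [nat_lit 7, nat_lit 11]
    [[nat_lit 0, nat_lit 1, nat_lit 2], [nat_lit 0, nat_lit 1, nat_lit 3]] = true := by
  decide +kernel

theorem dfs_two : dfsB 4 T20 [nat_lit 7, nat_lit 7]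
    [[nat_lit 0, nat_lit 1, nat_lit 2], [nat_lit 0, nat_lit 1, nat_lit 2]] = true := by
  decide +kernel

theorem bad_one (w : List (List ℕ)) (hw : w.length = 4) (h : ∀ t ∈ w, t ∈ T20.map Prod.snd) :
    Bad (w ++ [[0, 1, 2], [0, 1, 3]]) :=
  dfsB_sound 4 T20 _ _ dfs_one w hw h

theorem bad_two (w : List (List ℕ)) (hw : w.length = 4) (h : ∀ t ∈ w, t ∈ T20.map Prod.snd) :
    Bad (w ++ [[0, 1, 2], [0, 1, 2]]) :=
  dfsB_sound 4 T20 _ _ dfs_two w hw h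

/-- the edges of the incidence graph of a labelled hypergraph -/
def edgesOf {V : Type} (pt : ℕ → V) (W : List (V × List ℕ)) : List (Sym2 V) :=
  W.flatMap fun w => w.2.map fun i => s(w.1, pt i)

theorem edgesOf_cons {V : Type} (pt : ℕ → V) (w : V × List ℕ) (W : List (V × List ℕ)) :
    edgesOf pt (w :: W) = (w.2.map fun i => s(w.1, pt i)) ++ edgesOf pt W := by
  simp [edgesOf]

theorem zip_exists {α β γ : Type} (f : α → β) : ∀ (W : List α) (Q : List (β × γ)),
    Q.map Prod.fst = W.map f → ∃ Z : List (α × γ), Z.map Prod.fst = W ∧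
      Z.map (fun z => (f z.1, z.2)) = Q := by
  intro W
  induction W with
  | nil =>
    intro Q h
    exact ⟨[], rfl, by simpa using h.symm⟩
  | cons w W ih =>
    intro Q h
    match Q, h with
    | q :: Q, h =>
      simp only [List.map_cons, List.cons.injEq] at h
      obtain ⟨Z, h1, h2⟩ := ih Q h.2
      refine ⟨(w, q.2) :: Z, by simp [h1], ?_⟩
      simp only [List.map_cons, h2, ← h.1]

theorem edgesOf_subperm {V : Type} (pt : ℕ → V) : ∀ Z : List ((V × List ℕ) × List ℕ),
    (∀ z ∈ Z, z.2.Subperm z.1.2) →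
    (edgesOf pt (Z.map fun z => (z.1.1, z.2))).Subperm (edgesOf pt (Z.map Prod.fst)) := by
  intro Z
  induction Z with
  | nil => intro _; exact List.Subperm.refl _
  | cons z Z ih =>
    intro h
    simp only [List.map_cons, edgesOf_cons]
    have h1 := h z (by simp)
    have h2 := ih fun z' hz' => h z' (by simp [hz'])
    have h3 : (z.2.map fun i => s(z.1.1, pt i)).Subperm (z.1.2.map fun i => s(z.1.1, pt i)) := by
      obtain ⟨l, hl, hs⟩ := h1
      exact (hl.map _).symm.subperm.trans (hs.map _).subperm
    exact h3.append h2

theorem count_pt {V : Type} (pt : ℕ → V) (i : ℕ) : ∀ W : List (V × List ℕ),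
    (∀ w ∈ W, w.1 ≠ pt i) → (∀ w ∈ W, ∀ j ∈ w.2, pt j = pt i → j = i) →
    (edgesOf pt W).countP (fun e => pt i ∈ e) = (W.map Prod.snd).flatten.count i := by
  intro W
  induction W with
  | nil => intro _ _; rfl
  | cons w W ih =>
    intro h1 h2
    rw [edgesOf_cons, List.countP_append, ih (fun w hw => h1 w (by simp [hw]))
      (fun w hw => h2 w (by simp [hw]))]
    simp only [List.map_cons, List.flatten_cons, List.count_append]
    congr 1
    rw [List.countP_map, List.count]
    apply List.countP_congr
    intro j hj
    have a := h1 w (by simp)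
    have b := h2 w (by simp) j hj
    simp only [Function.comp_apply, Sym2.mem_iff, decide_eq_true_eq, beq_iff_eq]
    constructor
    · rintro (h | h)
      · exact (a h.symm).elim
      · exact b h.symm
    · rintro rfl
      exact Or.inr rfl

theorem count_y0 {V : Type} (pt : ℕ → V) (y : V) : ∀ W : List (V × List ℕ),
    (∀ w ∈ W, w.1 ≠ y) → (∀ w ∈ W, ∀ j ∈ w.2, pt j ≠ y) →
    (edgesOf pt W).countP (fun e => y ∈ e) = 0 := by
  intro W h1 h2
  rw [List.countP_eq_zero]
  intro e he
  simp only [edgesOf, List.mem_flatMap, List.mem_map] at he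
  obtain ⟨w, hw, i, hi, rfl⟩ := he
  have a := h1 w hw
  have b := h2 w hw i hi
  simp only [Sym2.mem_iff, decide_eq_true_eq]
  rintro (h | h)
  · exact a h.symm
  · exact b h.symm

theorem count_y {V : Type} (pt : ℕ → V) (y : V) (c : List ℕ) : ∀ W : List (V × List ℕ),
    (W.map Prod.fst).Nodup → (∀ w ∈ W, ∀ j ∈ w.2, pt j ≠ y) → (y, c) ∈ W →
    (edgesOf pt W).countP (fun e => y ∈ e) = c.length := by
  intro W
  induction W with
  | nil => intro _ _ h; simp at h
  | cons w W ih =>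
    intro h1 h2 h3
    rw [edgesOf_cons, List.countP_append]
    simp only [List.map_cons, List.nodup_cons, List.mem_map, not_exists, not_and] at h1
    rcases List.mem_cons.1 h3 with rfl | h3
    · rw [count_y0 pt y W (fun w hw => h1.1 w hw) (fun w hw => h2 w (by simp [hw]))]
      rw [List.countP_map, List.countP_eq_length.2]
      · rfl
      · intro j _
        simp
    · rw [ih h1.2 (fun w hw => h2 w (by simp [hw])) h3]
      have hne : w.1 ≠ y := fun h => h1.1 _ h3 h.symm
      have := count_y0 pt y [w] (by simpa using hne) (by
        intro w' hw'
        rw [List.mem_singleton.1 hw']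
        exact h2 w (by simp))
      rw [edgesOf_cons] at this
      simp only [edgesOf, List.flatMap_nil, List.append_nil] at this
      rw [this, Nat.zero_add]

theorem degIn_coe {V : Type} (L : List (Sym2 V)) (v : V) :
    Multigraph.degIn (L : Multiset (Sym2 V)) v = L.countP (fun e => v ∈ e) := by
  simp [Multigraph.degIn, List.countP_eq_length_filter]

theorem odd_iff_cast {n : ℕ} {p : Prop} (h : (n : ZMod 2) = if p then 1 else 0) : Odd n ↔ p := by
  rw [← ZMod.natCast_eq_one_iff_odd, h]
  by_cases hp : p <;> simp [hp]

theorem transfer_conn {V : Type} (P : Finset ℕ) (pt : ℕ → V) (W : List (V × List ℕ))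
    (hP : P.Nonempty) (hW : ∀ w ∈ W, ∀ j ∈ w.2, j ∈ P) (h : Conn P (W.map Prod.snd)) :
    Multigraph.ConnOn {v | (∃ i ∈ P, pt i = v) ∨ ∃ w ∈ W, w.1 = v}
      (edgesOf pt W : Multiset (Sym2 V)) := by
  refine ⟨?_, ?_, ?_⟩
  · obtain ⟨i, hi⟩ := hP
    exact ⟨pt i, Or.inl ⟨i, hi, rfl⟩⟩
  · intro e he v hv
    simp only [edgesOf, Multiset.mem_coe, List.mem_flatMap, List.mem_map] at he
    obtain ⟨w, hw, i, hi, rfl⟩ := he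
    rcases Sym2.mem_iff.1 hv with rfl | rfl
    · exact Or.inr ⟨w, hw, rfl⟩
    · exact Or.inl ⟨i, hW w hw i hi, rfl⟩
  · intro u hu
    set A : Set V := {v | Relation.ReflTransGen
      (fun a b => s(a, b) ∈ (edgesOf pt W : Multiset (Sym2 V))) u v} with hA
    have hstep : ∀ a b, s(a, b) ∈ (edgesOf pt W : Multiset (Sym2 V)) → (a ∈ A ↔ b ∈ A) := by
      intro a b hab
      constructor
      · intro ha
        exact Relation.ReflTransGen.tail ha hab
      · intro hb
        exact Relation.ReflTransGen.tail hb (by rw [Sym2.eq_swap]; exact hab)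
    obtain ⟨t, ht1, ht2⟩ := h (fun i => if pt i ∈ A then 1 else 0)
      (W.map fun w => (w.2, if w.1 ∈ A then 1 else 0)) (by simp) (by
        intro k hk i hi
        obtain ⟨w, hw, rfl⟩ := List.mem_map.1 hk
        have := hstep w.1 (pt i) (by
          simp only [edgesOf, Multiset.mem_coe, List.mem_flatMap, List.mem_map]
          exact ⟨w, hw, i, hi, rfl⟩)
        simp only [this])
    have key : ∀ v ∈ {v | (∃ i ∈ P, pt i = v) ∨ ∃ w ∈ W, w.1 = v},
        (if v ∈ A then (1 : ZMod 2) else 0) = t := by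
      rintro v (⟨i, hi, rfl⟩ | ⟨w, hw, rfl⟩)
      · exact ht1 i hi
      · exact ht2 (w.2, if w.1 ∈ A then 1 else 0) (List.mem_map.2 ⟨w, hw, rfl⟩)
    have h1 := key u hu
    have huA : u ∈ A := Relation.ReflTransGen.refl
    rw [if_pos huA] at h1
    intro v hv
    have h2 := key v hv
    rw [← h1] at h2
    by_contra hvA'
    have hvA : v ∉ A := hvA'
    rw [if_neg hvA] at h2
    exact zero_ne_one h2

theorem transfer {V : Type} (G : Multigraph V) (hred : G.Reduced) (P : Finset ℕ) (pt : ℕ → V)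
    (W : List (V × List ℕ)) (hP : P.Nonempty) (hne : W ≠ [])
    (hnd : (W.map Prod.fst).Nodup)
    (hinj : ∀ i ∈ P, ∀ j ∈ P, pt i = pt j → i = j)
    (hdis : ∀ w ∈ W, ∀ i ∈ P, w.1 ≠ pt i)
    (hW : ∀ w ∈ W, ∀ j ∈ w.2, j ∈ P)
    (hE : (edgesOf pt W : Multiset (Sym2 V)) ≤ G.edges)
    (hC : Coll P (W.map Prod.snd)) : False := by
  set S : Set V := {v | (∃ i ∈ P, pt i = v) ∨ ∃ w ∈ W, w.1 = v} with hS
  set SF : Finset V := P.image pt ∪ (W.map Prod.fst).toFinset with hSF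
  have hSS : S = (SF : Set V) := by
    ext v
    simp [hS, hSF]
  have hin : Multigraph.Within S (edgesOf pt W : Multiset (Sym2 V)) := by
    intro e he v hv
    simp only [edgesOf, Multiset.mem_coe, List.mem_flatMap, List.mem_map] at he
    obtain ⟨w, hw, i, hi, rfl⟩ := he
    rcases Sym2.mem_iff.1 hv with rfl | rfl
    · exact Or.inr ⟨w, hw, rfl⟩
    · exact Or.inl ⟨i, hW w hw i hi, rfl⟩
  have hdisj : Disjoint (P.image pt) (W.map Prod.fst).toFinset := by
    rw [Finset.disjoint_left]
    intro v hv hv'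
    simp only [Finset.mem_image, List.mem_toFinset, List.mem_map] at hv hv'
    obtain ⟨i, hi, rfl⟩ := hv
    obtain ⟨w, hw, hwi⟩ := hv'
    exact hdis w hw i hi hwi
  have hcard := hred S _ ⟨hE, hin⟩ ⟨?_, hin, ?_⟩
  · rw [hSS, Set.ncard_coe_finset, hSF, Finset.card_union_of_disjoint hdisj] at hcard
    have h1 : 0 < (P.image pt).card := Finset.card_pos.2 (hP.image _)
    have h2 : 0 < (W.map Prod.fst).toFinset.card := by
      rw [List.toFinset_card_of_nodup hnd, List.length_map]
      exact List.length_pos_iff.2 hne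
    omega
  · obtain ⟨i, hi⟩ := hP
    exact ⟨pt i, Or.inl ⟨i, hi, rfl⟩⟩
  intro R hR hRf hRe
  have hsum : ∑ x ∈ P, (if pt x ∈ R then (1 : ZMod 2) else 0)
      = ((W.map fun w => (w.2, if w.1 ∈ R then (1 : ZMod 2) else 0)).map Prod.snd).sum := by
    have h0 : ∑ v ∈ SF, (if v ∈ R then (1 : ZMod 2) else 0) = 0 := by
      rw [Finset.sum_boole]
      have : R = ((SF.filter fun v => v ∈ R : Finset V) : Set V) := by
        ext v
        simp only [Finset.coe_filter, Set.mem_ofPred_eq]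
        refine ⟨fun h => ⟨?_, h⟩, fun h => h.2⟩
        have := hR h
        rw [hSS] at this
        exact this
      rw [this, Set.ncard_coe_finset] at hRe
      exact (ZMod.natCast_eq_zero_iff_even).2 hRe
    rw [hSF, Finset.sum_union hdisj, Finset.sum_image (fun i hi j hj => hinj i hi j hj),
      List.sum_toFinset _ hnd] at h0
    rw [List.map_map] at h0 ⊢
    exact (CharTwo.add_eq_zero).1 h0
  obtain ⟨Q, hQ, hv, hc, hco⟩ := hC _ _ (by simp) hsum
  obtain ⟨Z, hZ, hZQ⟩ := zip_exists _ _ _ hQ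
  subst hZQ
  set W' : List (V × List ℕ) := Z.map fun z => (z.1.1, z.2) with hW'
  have hsubZ : ∀ z ∈ Z, z.2.Subperm z.1.2 := fun z hz =>
    (hv _ (List.mem_map.2 ⟨z, hz, rfl⟩)).1
  have hZW : ∀ z ∈ Z, z.1 ∈ W := fun z hz => by
    rw [← hZ]; exact List.mem_map.2 ⟨z, hz, rfl⟩
  have hW'P : ∀ w ∈ W', ∀ j ∈ w.2, j ∈ P := by
    intro w hw j hj
    obtain ⟨z, hz, rfl⟩ := List.mem_map.1 hw
    exact hW z.1 (hZW z hz) j ((hsubZ z hz).subset hj)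
  have hW'd : ∀ w ∈ W', ∀ i ∈ P, w.1 ≠ pt i := by
    intro w hw
    obtain ⟨z, hz, rfl⟩ := List.mem_map.1 hw
    exact hdis z.1 (hZW z hz)
  have hfst : W'.map Prod.fst = W.map Prod.fst := by
    rw [hW', ← hZ]
    simp
  have hsnd : W'.map Prod.snd = (Z.map fun z =>
      ((z.1.2, if z.1.1 ∈ R then (1 : ZMod 2) else 0), z.2)).map Prod.snd := by
    rw [hW']
    simp
  refine ⟨(edgesOf pt W' : Multiset (Sym2 V)), ?_, ?_, ?_⟩
  · have := edgesOf_subperm pt Z hsubZ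
    rw [hZ] at this
    exact Multiset.coe_le.2 this
  · have := transfer_conn P pt W' hP hW'P (by rw [hsnd]; exact hco)
    convert this using 1
    ext v
    have e : (∃ w ∈ W, w.1 = v) ↔ ∃ w ∈ W', w.1 = v := by
      have e1 : (∃ w ∈ W, w.1 = v) ↔ v ∈ W.map Prod.fst := by simp
      have e2 : (∃ w ∈ W', w.1 = v) ↔ v ∈ W'.map Prod.fst := by simp
      rw [e1, e2, hfst]
    simp only [hS, Set.mem_ofPred_eq, e]
  · intro v hvS
    rw [degIn_coe]
    apply odd_iff_cast
    rcases hvS with ⟨i, hi, rfl⟩ | ⟨w, hw, rfl⟩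
    · rw [count_pt pt i W' (fun w hw => hW'd w hw i hi)
        (fun w hw j hj h => hinj j (hW'P w hw j hj) i hi h), hsnd]
      exact hc i hi
    · rw [← hZ] at hw
      obtain ⟨z, hz, rfl⟩ := List.mem_map.1 hw
      rw [count_y pt z.1.1 z.2 W' (by rw [hfst]; exact hnd)
        (fun w hw j hj h => hdis z.1 (hZW z hz) j (hW'P w hw j hj) h.symm)
        (List.mem_map.2 ⟨z, hz, rfl⟩)]
      exact (hv _ (List.mem_map.2 ⟨z, hz, rfl⟩)).2

theorem subperm_lift {α β : Type*} (f : α → β) (W : List α) (M : List β)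
    (h : M.Subperm (W.map f)) : ∃ W' : List α, W'.Subperm W ∧ W'.map f = M := by
  obtain ⟨l, hl, hs⟩ := h
  obtain ⟨l', hl', rfl⟩ := List.sublist_map_iff.1 hs
  obtain ⟨W', hW', rfl⟩ := perm_lift f l' M hl
  exact ⟨W', hW'.subperm.trans hl'.subperm, rfl⟩

theorem edgesOf_mono {V : Type} (pt : ℕ → V) {W W' : List (V × List ℕ)} (h : W'.Subperm W) :
    (edgesOf pt W').Subperm (edgesOf pt W) := by
  obtain ⟨l, hl, hs⟩ := h
  have h1 : (edgesOf pt l).Perm (edgesOf pt W') := hl.flatMap_right _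
  have h2 : (edgesOf pt l).Sublist (edgesOf pt W) := by
    unfold edgesOf
    rw [List.flatMap_def, List.flatMap_def]
    exact (hs.map _).flatten
  exact h1.symm.subperm.trans h2.subperm

theorem Coll.covers {P : Finset ℕ} {L : List (List ℕ)} (h : Coll P L) (hL : L ≠ []) :
    ∀ x ∈ P, ∃ l ∈ L, x ∈ l := by
  intro x hx
  by_contra hcon
  push Not at hcon
  obtain ⟨Q, hQ, hv, -, hco⟩ := h (L.map fun l => (l, 0)) (fun _ => 0)
    (by simp [Function.comp_def]) (by simp [Function.comp_def])
  have hQn : Q ≠ [] := by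
    rintro rfl
    exact hL (by simpa using hQ.symm)
  obtain ⟨t, h1, h2⟩ := hco (fun y => if y = x then 1 else 0) (Q.map fun q => (q.2, 0)) (by simp) (by
    intro k hk u hu
    obtain ⟨q, hq, rfl⟩ := List.mem_map.1 hk
    have hq1 : q.1 ∈ L.map fun l => (l, (0 : ZMod 2)) := by
      rw [← hQ]; exact List.mem_map.2 ⟨q, hq, rfl⟩
    obtain ⟨l, hl, hlq⟩ := List.mem_map.1 hq1
    have hul : u ∈ l := by
      have := (hv q hq).1.subset hu
      rw [← hlq] at this
      exact this
    have : u ≠ x := by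
      rintro rfl
      exact hcon l hl hul
    simp [this])
  obtain ⟨q, hq⟩ := List.exists_mem_of_ne_nil Q hQn
  have a := h1 x hx
  have b := h2 (q.2, 0) (List.mem_map.2 ⟨q, hq, rfl⟩)
  simp only [if_true] at a b
  rw [← b] at a
  exact one_ne_zero a

theorem transfer_bad {V : Type} (G : Multigraph V) (hred : G.Reduced) (pt : ℕ → V)
    (P : Finset ℕ)
    (W : List (V × List ℕ))
    (hnd : (W.map Prod.fst).Nodup)
    (hinj : ∀ i ∈ P, ∀ j ∈ P, pt i = pt j → i = j)
    (hdis : ∀ w ∈ W, ∀ i ∈ P, w.1 ≠ pt i)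
    (hW : ∀ w ∈ W, ∀ j ∈ w.2, j ∈ P)
    (hE : (edgesOf pt W : Multiset (Sym2 V)) ≤ G.edges)
    (hB : Bad (W.map Prod.snd)) : False := by
  obtain ⟨S, M, hM, hS, hM0, hC⟩ := hB
  obtain ⟨W', hW', rfl⟩ := subperm_lift Prod.snd W M hM
  have hSP : ∀ i ∈ S.toFinset, i ∈ P := by
    intro i hi
    obtain ⟨l, hl, hil⟩ := hC.covers (by simpa using hM0) i hi
    simp only [List.map_map, List.mem_map, Function.comp_apply] at hl
    obtain ⟨w, hw, rfl⟩ := hl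
    exact hW w (hW'.subset hw) i ((resB_sublist S w.2).subset hil)
  have hsub := edgesOf_subperm pt (W'.map fun w => (w, resB S w.2)) (by
    intro z hz
    obtain ⟨w, _, rfl⟩ := List.mem_map.1 hz
    exact (resB_sublist S w.2).subperm)
  simp only [List.map_map] at hsub
  have e1 : W'.map (Prod.fst ∘ fun w => (w, resB S w.2)) = W' := by
    simp [Function.comp_def]
  rw [e1] at hsub
  refine transfer G hred S.toFinset pt
    (W'.map ((fun z : (V × List ℕ) × List ℕ => (z.1.1, z.2)) ∘ fun w => (w, resB S w.2)))
    (by simpa using hS) (by simpa using hM0) ?_ ?_ ?_ ?_ ?_ ?_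
  · rw [List.map_map]
    have hsp : (W'.map Prod.fst).Subperm (W.map Prod.fst) := by
      obtain ⟨l, hl, hs⟩ := hW'
      exact (hl.map _).symm.subperm.trans (hs.map _).subperm
    obtain ⟨l, hl, hs⟩ := hsp
    exact hl.nodup_iff.1 (hs.nodup hnd)
  · intro i hi j hj
    exact hinj i (hSP i hi) j (hSP j hj)
  · intro w hw i hi
    obtain ⟨w', hw', rfl⟩ := List.mem_map.1 hw
    exact hdis w' (hW'.subset hw') i (hSP i hi)
  · intro w hw j hj
    obtain ⟨w', hw', rfl⟩ := List.mem_map.1 hw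
    exact List.mem_toFinset.2 (resB_mem S w'.2 j hj)
  · exact (Multiset.coe_le.2 (hsub.trans (edgesOf_mono pt hW'))).trans hE
  · rw [List.map_map] at hC ⊢
    exact hC

theorem transfer_bad' {V : Type} (G : Multigraph V) (hred : G.Reduced) (pt : ℕ → V)
    (P : Finset ℕ)
    (W : List (V × List ℕ))
    (hnd : (W.map Prod.fst).Nodup)
    (hinj : ∀ i ∈ P, ∀ j ∈ P, pt i = pt j → i = j)
    (hdis : ∀ w ∈ W, ∀ i ∈ P, w.1 ≠ pt i)
    (hW : ∀ w ∈ W, ∀ j ∈ w.2, j ∈ P)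
    (hWn : ∀ w ∈ W, w.2.Nodup)
    (hE : ∀ w ∈ W, ∀ i ∈ w.2, s(w.1, pt i) ∈ G.edges)
    (hB : Bad (W.map Prod.snd)) : False := by
  refine transfer_bad G hred pt P W hnd hinj hdis hW ?_ hB
  rw [Multiset.le_iff_subset]
  · intro e he
    simp only [edgesOf, Multiset.mem_coe, List.mem_flatMap, List.mem_map] at he
    obtain ⟨w, hw, i, hi, rfl⟩ := he
    exact hE w hw i hi
  · rw [Multiset.coe_nodup, edgesOf, List.nodup_flatMap]
    refine ⟨?_, ?_⟩
    · intro w hw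
      refine List.Nodup.map_on ?_ (hWn w hw)
      intro i hi j hj hij
      exact hinj i (hW w hw i hi) j (hW w hw j hj) (Sym2.congr_right.1 hij)
    · have h1 : W.Pairwise (fun w w' => w.1 ≠ w'.1) := List.pairwise_map.1 hnd
      refine h1.imp_of_mem ?_
      intro w w' hw hw' hne e he he'
      obtain ⟨i, hi, rfl⟩ := List.mem_map.1 he
      obtain ⟨j, hj, hij⟩ := List.mem_map.1 he'
      have : w.1 ∈ s(w'.1, pt j) := by rw [hij]; exact Sym2.mem_mk_left _ _
      rcases Sym2.mem_iff.1 this with h | h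
      · exact hne h
      · exact hdis w hw j (hW w' hw' j hj) h

theorem edges_nodup {V : Type} (G : Multigraph V) (hred : G.Reduced) : G.edges.Nodup := by
  rw [Multiset.nodup_iff_le]
  intro e
  induction e with
  | _ a b =>
    intro hle
    have hab : a ≠ b := by
      intro h
      exact G.loopless s(a, b) (Multiset.subset_of_le hle (by simp)) (by simpa using h)
    refine transfer G hred {0} (fun _ => b) [(a, [0, 0])] (by simp) (by simp) (by simp)
      (by simp) (by simpa using hab) (by simp) hle ?_
    exact Coll.base 0 _ (by simp)

theorem mem_T20 (t : List ℕ) (h : t.Sublist [0, 1, 2, 3, 4, 5]) (hl : t.length = 3) :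
    t ∈ T20.map Prod.snd := by
  have h1 : t ∈ List.sublistsLen 3 [0, 1, 2, 3, 4, 5] := List.mem_sublistsLen.2 ⟨h, hl⟩
  have h2 : ∀ t ∈ List.sublistsLen 3 [0, 1, 2, 3, 4, 5], t ∈ T20.map Prod.snd := by decide
  exact h2 t h1

theorem six_core {V : Type} (G : Multigraph V) (hred : G.Reduced) (l : List V) (v0 : V)
    (hl : l.Nodup) (hlen : l.length = 6) (Y4 : Finset V) (hY4 : Y4.card = 4) (y1 y2 : V)
    (h12 : y1 ≠ y2) (h1 : y1 ∉ Y4) (h2 : y2 ∉ Y4) (hd : ∀ y ∈ Y4, y ∉ l) (hd1 : y1 ∉ l)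
    (hd2 : y2 ∉ l) (T : V → Finset V) (hT : ∀ y ∈ Y4, (T y).card = 3)
    (hTl : ∀ y ∈ Y4, ∀ x ∈ T y, x ∈ l)
    (hE : ∀ y ∈ Y4, ∀ x ∈ T y, s(y, x) ∈ G.edges)
    (q : List ℕ) (hq : q = [0, 1, 2] ∨ q = [0, 1, 3])
    (hE1 : ∀ i ∈ [0, 1, 2], s(y1, l.getD i v0) ∈ G.edges)
    (hE2 : ∀ i ∈ q, s(y2, l.getD i v0) ∈ G.edges) : False := by
  set pt : ℕ → V := fun i => l.getD i v0 with hpt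
  set idx : V → List ℕ := fun y => [0, 1, 2, 3, 4, 5].filter fun i => pt i ∈ T y with hidx
  have hptmem : ∀ i < 6, pt i ∈ l := by
    intro i hi
    simp only [hpt]
    rw [List.getD_eq_getElem _ _ (by omega)]
    exact List.getElem_mem _
  have hinj : ∀ i < 6, ∀ j < 6, pt i = pt j → i = j := by
    intro i hi j hj h
    simp only [hpt] at h
    rw [List.getD_eq_getElem _ _ (by omega), List.getD_eq_getElem _ _ (by omega)] at h
    exact (hl.getElem_inj_iff).1 h
  have hr : ∀ i, i ∈ [0, 1, 2, 3, 4, 5] ↔ i < 6 := by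
    intro i
    simp only [List.mem_cons, List.not_mem_nil, or_false]
    omega
  have hidxsub : ∀ y, (idx y).Sublist [0, 1, 2, 3, 4, 5] := fun y => List.filter_sublist
  have hidxnd : ∀ y, (idx y).Nodup := fun y => (hidxsub y).nodup (by decide)
  have hidxT : ∀ y ∈ Y4, idx y ∈ T20.map Prod.snd := by
    intro y hy
    refine mem_T20 _ (hidxsub y) ?_
    rw [← hT y hy, ← List.toFinset_card_of_nodup (hidxnd y)]
    refine Finset.card_bij (fun i _ => pt i) ?_ ?_ ?_
    · intro i hi
      simp only [hidx, List.mem_toFinset, List.mem_filter, decide_eq_true_eq] at hi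
      exact hi.2
    · intro i hi j hj h
      have a := (hidxsub y).subset (List.mem_toFinset.1 hi)
      have b := (hidxsub y).subset (List.mem_toFinset.1 hj)
      exact hinj i ((hr i).1 a) j ((hr j).1 b) h
    · intro x hx
      obtain ⟨i, hi, hix⟩ := List.mem_iff_getElem.1 (hTl y hy x hx)
      have hpi : pt i = x := by
        simp only [hpt]
        rw [List.getD_eq_getElem _ _ hi, hix]
      refine ⟨i, ?_, hpi⟩
      simp only [hidx, List.mem_toFinset, List.mem_filter, decide_eq_true_eq]
      exact ⟨(hr i).2 (by omega), by rw [hpi]; exact hx⟩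
  set w0 : List (V × List ℕ) := Y4.toList.map fun y => (y, idx y) with hw0
  have hmem : ∀ w ∈ w0 ++ [(y1, [0, 1, 2]), (y2, q)],
      (∃ y ∈ Y4, w = (y, idx y)) ∨ w = (y1, [0, 1, 2]) ∨ w = (y2, q) := by
    intro w hw
    rcases List.mem_append.1 hw with hw | hw
    · obtain ⟨y, hy, rfl⟩ := List.mem_map.1 hw
      exact Or.inl ⟨y, Finset.mem_toList.1 hy, rfl⟩
    · right
      simpa using hw
  refine transfer_bad' G hred pt (Finset.range 6) (w0 ++ [(y1, [0, 1, 2]), (y2, q)])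
    ?_ ?_ ?_ ?_ ?_ ?_ ?_
  · have e : (w0 ++ [(y1, [0, 1, 2]), (y2, q)]).map Prod.fst = Y4.toList ++ [y1, y2] := by
      simp [hw0, Function.comp_def]
    rw [e, List.nodup_append]
    refine ⟨Finset.nodup_toList _, by simpa using h12, ?_⟩
    intro a ha b hb
    rw [Finset.mem_toList] at ha
    simp only [List.mem_cons, List.not_mem_nil, or_false] at hb
    rintro rfl
    rcases hb with rfl | rfl
    · exact h1 ha
    · exact h2 ha
  · intro i hi j hj
    exact hinj i (Finset.mem_range.1 hi) j (Finset.mem_range.1 hj)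
  · intro w hw i hi h
    have hm := hptmem i (Finset.mem_range.1 hi)
    rw [← h] at hm
    rcases hmem w hw with ⟨y, hy, rfl⟩ | rfl | rfl
    · exact hd y hy hm
    · exact hd1 hm
    · exact hd2 hm
  · intro w hw j hj
    rw [Finset.mem_range]
    rcases hmem w hw with ⟨y, hy, rfl⟩ | rfl | rfl
    · exact (hr j).1 ((hidxsub y).subset hj)
    · simp at hj
      omega
    · rcases hq with rfl | rfl <;> simp at hj <;> omega
  · intro w hw
    rcases hmem w hw with ⟨y, hy, rfl⟩ | rfl | rfl
    · exact hidxnd y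
    · simp
    · rcases hq with rfl | rfl <;> simp
  · intro w hw i hi
    rcases hmem w hw with ⟨y, hy, rfl⟩ | rfl | rfl
    · simp only [hidx, List.mem_filter, decide_eq_true_eq] at hi
      exact hE y hy _ hi.2
    · exact hE1 i hi
    · exact hE2 i hi
  · have e : (w0 ++ [(y1, [0, 1, 2]), (y2, q)]).map Prod.snd
        = w0.map Prod.snd ++ [[0, 1, 2], q] := by simp
    have hlen4 : (w0.map Prod.snd).length = 4 := by
      simp [hw0, hY4]
    have hall : ∀ t ∈ w0.map Prod.snd, t ∈ T20.map Prod.snd := by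
      intro t ht
      obtain ⟨w, hw, rfl⟩ := List.mem_map.1 ht
      obtain ⟨y, hy, rfl⟩ := List.mem_map.1 hw
      exact hidxT y (Finset.mem_toList.1 hy)
    rw [e]
    rcases hq with rfl | rfl
    · exact bad_two _ hlen4 hall
    · exact bad_one _ hlen4 hall

theorem third {V : Type} {T : Finset V} {a b : V} (hT : T.card = 3) (hab : a ≠ b) (ha : a ∈ T)
    (hb : b ∈ T) : ∃ c, c ≠ a ∧ c ≠ b ∧ c ∈ T := by
  have h : 0 < ((T.erase a).erase b).card := by
    rw [Finset.card_erase_of_mem (Finset.mem_erase.2 ⟨hab.symm, hb⟩), Finset.card_erase_of_mem ha]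
    omega
  obtain ⟨c, hc⟩ := Finset.card_pos.1 h
  simp only [Finset.mem_erase] at hc
  exact ⟨c, hc.2.1, hc.1, hc.2.2⟩

theorem six_six {V : Type} (G : Multigraph V) (hred : G.Reduced) (A Y6 : Finset V)
    (hA : A.card = 6) (hY : Y6.card = 6) (hd : ∀ y ∈ Y6, y ∉ A) (T : V → Finset V)
    (hT : ∀ y ∈ Y6, (T y).card = 3) (hTA : ∀ y ∈ Y6, T y ⊆ A)
    (hE : ∀ y ∈ Y6, ∀ x ∈ T y, s(y, x) ∈ G.edges) : False := by
  have hcard : (Finset.powersetCard 2 A).card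
      < (Y6.sigma fun y => Finset.powersetCard 2 (T y)).card := by
    rw [Finset.card_sigma, Finset.sum_congr rfl (g := fun _ => 3), Finset.card_powersetCard, hA]
    · simp [hY, Nat.choose]
    · intro y hy
      rw [Finset.card_powersetCard, hT y hy]
      rfl
  obtain ⟨⟨y1, p⟩, hz1, ⟨y2, p2⟩, hz2, hne, heq⟩ :=
    Finset.exists_ne_map_eq_of_card_lt_of_maps_to hcard (f := fun z => z.2) (by
      intro z hz
      simp only [Finset.coe_sigma, Set.mem_sigma_iff, Finset.mem_coe,
        Finset.mem_powersetCard] at hz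
      simp only [Finset.mem_coe, Finset.mem_powersetCard]
      exact ⟨hz.2.1.trans (hTA _ hz.1), hz.2.2⟩)
  simp only at heq
  subst heq
  have h12 : y1 ≠ y2 := by
    rintro rfl
    exact hne rfl
  simp only [Finset.mem_sigma, Finset.mem_powersetCard] at hz1 hz2
  obtain ⟨hy1, hp1, hp⟩ := hz1
  obtain ⟨hy2, hp2, -⟩ := hz2
  obtain ⟨a, b, hab, rfl⟩ := Finset.card_eq_two.1 hp
  have ha1 : a ∈ T y1 := hp1 (by simp)
  have hb1 : b ∈ T y1 := hp1 (by simp)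
  have ha2 : a ∈ T y2 := hp2 (by simp)
  have hb2 : b ∈ T y2 := hp2 (by simp)
  obtain ⟨c, hca, hcb, hc⟩ := third (hT y1 hy1) hab ha1 hb1
  obtain ⟨d, hda, hdb, hd'⟩ := third (hT y2 hy2) hab ha2 hb2
  set Y4 := (Y6.erase y1).erase y2 with hY4
  have hY4c : Y4.card = 4 := by
    rw [hY4, Finset.card_erase_of_mem (Finset.mem_erase.2 ⟨h12.symm, hy2⟩),
      Finset.card_erase_of_mem hy1]
    omega
  have hY46 : ∀ y ∈ Y4, y ∈ Y6 := fun y hy =>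
    Finset.mem_of_mem_erase (Finset.mem_of_mem_erase hy)
  have hn1 : y1 ∉ Y4 := by simp [hY4]
  have hn2 : y2 ∉ Y4 := by simp [hY4]
  have main : ∀ (m : List V) (q : List ℕ), m.Nodup → (∀ x ∈ m, x ∈ A) →
      (q = [0, 1, 2] ∨ q = [0, 1, 3]) →
      (∀ i ∈ [0, 1, 2], s(y1, (m ++ (A \ m.toFinset).toList).getD i a) ∈ G.edges) →
      (∀ i ∈ q, s(y2, (m ++ (A \ m.toFinset).toList).getD i a) ∈ G.edges) → False := by
    intro m q hm hmA hq hE1 hE2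
    have hlA : ∀ x, x ∈ m ++ (A \ m.toFinset).toList ↔ x ∈ A := by
      intro x
      simp only [List.mem_append, Finset.mem_toList, Finset.mem_sdiff, List.mem_toFinset]
      constructor
      · rintro (h | h)
        · exact hmA x h
        · exact h.1
      · intro h
        by_cases hx : x ∈ m
        · exact Or.inl hx
        · exact Or.inr ⟨h, hx⟩
    have hlnd : (m ++ (A \ m.toFinset).toList).Nodup := by
      rw [List.nodup_append]
      refine ⟨hm, Finset.nodup_toList _, ?_⟩
      rintro x hx _ hy rfl
      simp only [Finset.mem_toList, Finset.mem_sdiff, List.mem_toFinset] at hy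
      exact hy.2 hx
    refine six_core G hred (m ++ (A \ m.toFinset).toList) a hlnd ?_ Y4 hY4c y1 y2 h12 hn1 hn2
      ?_ ?_ ?_ T (fun y hy => hT y (hY46 y hy)) ?_ (fun y hy => hE y (hY46 y hy)) q hq hE1 hE2
    · rw [← List.toFinset_card_of_nodup hlnd, ← hA]
      congr 1
      ext x
      rw [List.mem_toFinset, hlA]
    · intro y hy
      rw [hlA]
      exact hd y (hY46 y hy)
    · rw [hlA]
      exact hd y1 hy1
    · rw [hlA]
      exact hd y2 hy2
    · intro y hy x hx
      rw [hlA]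
      exact hTA y (hY46 y hy) hx
  by_cases hcd : c = d
  · subst hcd
    refine main [a, b, c] [0, 1, 2] (by simp [hab, hca.symm, hcb.symm]) ?_ (Or.inl rfl) ?_ ?_
    · intro x hx
      simp only [List.mem_cons, List.not_mem_nil, or_false] at hx
      rcases hx with rfl | rfl | rfl
      · exact hTA y1 hy1 ha1
      · exact hTA y1 hy1 hb1
      · exact hTA y1 hy1 hc
    · intro i hi
      simp only [List.mem_cons, List.not_mem_nil, or_false] at hi
      rcases hi with rfl | rfl | rfl
      · exact hE y1 hy1 a ha1
      · exact hE y1 hy1 b hb1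
      · exact hE y1 hy1 c hc
    · intro i hi
      simp only [List.mem_cons, List.not_mem_nil, or_false] at hi
      rcases hi with rfl | rfl | rfl
      · exact hE y2 hy2 a ha2
      · exact hE y2 hy2 b hb2
      · exact hE y2 hy2 c hd'
  · refine main [a, b, c, d] [0, 1, 3]
      (by simp [hab, hca.symm, hcb.symm, hda.symm, hdb.symm, hcd]) ?_ (Or.inr rfl) ?_ ?_
    · intro x hx
      simp only [List.mem_cons, List.not_mem_nil, or_false] at hx
      rcases hx with rfl | rfl | rfl | rfl
      · exact hTA y1 hy1 ha1
      · exact hTA y1 hy1 hb1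
      · exact hTA y1 hy1 hc
      · exact hTA y2 hy2 hd'
    · intro i hi
      simp only [List.mem_cons, List.not_mem_nil, or_false] at hi
      rcases hi with rfl | rfl | rfl
      · exact hE y1 hy1 a ha1
      · exact hE y1 hy1 b hb1
      · exact hE y1 hy1 c hc
    · intro i hi
      simp only [List.mem_cons, List.not_mem_nil, or_false] at hi
      rcases hi with rfl | rfl | rfl
      · exact hE y2 hy2 a ha2
      · exact hE y2 hy2 b hb2
      · exact hE y2 hy2 d hd'

theorem nine_seven {V : Type} (G : Multigraph V) (hred : G.Reduced) (X7 Y9 : Finset V)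
    (hX : X7.card = 7) (hY : Y9.card = 9) (hd : ∀ y ∈ Y9, y ∉ X7) (T : V → Finset V)
    (hT : ∀ y ∈ Y9, (T y).card = 3) (hTX : ∀ y ∈ Y9, T y ⊆ X7)
    (hE : ∀ y ∈ Y9, ∀ x ∈ T y, s(y, x) ∈ G.edges) : False := by
  have hv : ∃ v ∈ X7, (Y9.filter fun y => v ∈ T y).card ≤ 3 := by
    by_contra hcon
    push Not at hcon
    have h1 : ∑ v ∈ X7, (Y9.filter fun y => v ∈ T y).card = 27 := by
      have e : ∑ v ∈ X7, (Y9.filter fun y => v ∈ T y).card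
          = ∑ y ∈ Y9, (X7.filter fun v => v ∈ T y).card := by
        simp only [Finset.card_filter]
        exact Finset.sum_comm
      rw [e, Finset.sum_congr rfl (g := fun _ => 3)]
      · simp [hY]
      · intro y hy
        rw [← hT y hy]
        congr 1
        ext x
        simp only [Finset.mem_filter]
        exact ⟨fun h => h.2, fun h => ⟨hTX y hy h, h⟩⟩
    have h2 : X7.card • 4 ≤ ∑ v ∈ X7, (Y9.filter fun y => v ∈ T y).card :=
      Finset.card_nsmul_le_sum _ _ _ fun v hv => hcon v hv
    rw [h1, hX] at h2
    simp at h2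
  obtain ⟨v, hvX, hv3⟩ := hv
  have h6 : 6 ≤ (Y9.filter fun y => v ∉ T y).card := by
    have := Finset.card_filter_add_card_filter_not (s := Y9) (fun y => v ∈ T y)
    omega
  obtain ⟨Y6, hY6, hY6c⟩ := Finset.exists_subset_card_eq h6
  have hm : ∀ y ∈ Y6, y ∈ Y9 ∧ v ∉ T y := fun y hy => Finset.mem_filter.1 (hY6 hy)
  refine six_six G hred (X7.erase v) Y6 (by rw [Finset.card_erase_of_mem hvX, hX]) hY6c ?_ T
    (fun y hy => hT y (hm y hy).1) ?_ (fun y hy => hE y (hm y hy).1)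
  · intro y hy h
    exact hd y (hm y hy).1 (Finset.mem_of_mem_erase h)
  · intro y hy x hx
    refine Finset.mem_erase.2 ⟨?_, hTX y (hm y hy).1 hx⟩
    rintro rfl
    exact (hm y hy).2 hx

theorem triple {V : Type} [Fintype V] (EH : Multiset (Sym2 V)) (hn : EH.Nodup) (X Y : Finset V)
    (hbip : Multigraph.IsBipartition X Y EH) (y : V) (hy : y ∈ Y)
    (hdeg : 3 ≤ Multigraph.degIn EH y) :
    ∃ T : Finset V, T ⊆ X ∧ T.card = 3 ∧ ∀ x ∈ T, s(y, x) ∈ EH := by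
  have hyX : y ∉ X := fun h => Finset.disjoint_left.1 hbip.1 h hy
  have hsub : (EH.filter fun e => y ∈ e).toFinset
      ⊆ (X.filter fun x => s(y, x) ∈ EH).image fun x => s(y, x) := by
    intro e he
    simp only [Multiset.mem_toFinset, Multiset.mem_filter] at he
    obtain ⟨heE, z, rfl⟩ := he
    obtain ⟨⟨a, ha, haX⟩, -⟩ := hbip.2.2 _ heE
    have haz : a = z := by
      rcases Sym2.mem_iff.1 ha with rfl | h
      · exact (hyX haX).elim
      · exact h
    subst haz
    exact Finset.mem_image.2 ⟨a, Finset.mem_filter.2 ⟨haX, heE⟩, rfl⟩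
  have hc : 3 ≤ (X.filter fun x => s(y, x) ∈ EH).card := by
    have h1 := (Finset.card_le_card hsub).trans Finset.card_image_le
    rw [Multiset.toFinset_card_of_nodup (hn.filter _)] at h1
    exact hdeg.trans h1
  obtain ⟨T, hT, hTc⟩ := Finset.exists_subset_card_eq hc
  exact ⟨T, hT.trans (Finset.filter_subset _ _), hTc,
    fun x hx => (Finset.mem_filter.1 (hT hx)).2⟩

theorem final {V : Type} [Fintype V] (G : Multigraph V) (hred : G.Reduced)
    (hn : 16 ≤ Fintype.card V) (X Y : Finset V) (EH : Multiset (Sym2 V)) (hsub : EH ≤ G.edges)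
    (hbip : Multigraph.IsBipartition X Y EH) (hX7 : X.card ≤ 7)
    (hdeg : ∀ y ∈ Y, 3 ≤ Multigraph.degIn EH y) : False := by
  have hnd : EH.Nodup := Multiset.nodup_of_le hsub (edges_nodup G hred)
  have hcard : X.card + Y.card = Fintype.card V := by
    rw [← Finset.card_union_of_disjoint hbip.1, hbip.2.1, Finset.card_univ]
  obtain ⟨Y9, hY9, hY9c⟩ := Finset.exists_subset_card_eq (show 9 ≤ Y.card by omega)
  have hXc : X ⊆ Y9ᶜ := by
    intro x hx
    rw [Finset.mem_compl]
    exact fun h => Finset.disjoint_left.1 hbip.1 hx (hY9 h)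
  obtain ⟨X7, hXX7, hX7Y, hX7c⟩ := Finset.exists_subsuperset_card_eq hXc hX7
    (by rw [Finset.card_compl]; omega)
  choose! T hTX hT3 hTE using fun y (hy : y ∈ Y) => triple EH hnd X Y hbip y hy (hdeg y hy)
  refine nine_seven G hred X7 Y9 hX7c hY9c ?_ T (fun y hy => hT3 y (hY9 hy))
    (fun y hy => (hTX y (hY9 hy)).trans hXX7)
    (fun y hy x hx => Multiset.subset_of_le hsub (hTE y (hY9 hy) x hx))
  intro y hy h
  exact Finset.mem_compl.1 (hX7Y h) hy

end Hyp

/-- proof of Theorem 3.3(c), case `n ≥ 16`. Let `G` be a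
3-edge-connected reduced graph of order `n ≥ 16` that is not supereulerian, and suppose
`G` has a spanning bipartite subgraph `H` with bipartition `{X, Y}` where `|X| ≤ 7`,
`|Y| ≥ |X|` and `d_H(v) ≥ 3` for every `v ∈ Y`.  Then `G = H`, `F(G) = 3` and `G` has no
4-cycle; consequently no such `G` exists (every 3-edge-connected reduced graph of order at
least 16 with such a spanning bipartite subgraph is supereulerian). -/
theorem statement12 {V : Type} [Fintype V] (G : Multigraph V)
    (h3 : G.ThreeEdgeConnected) (hred : G.Reduced)
    (hn : 16 ≤ Fintype.card V) (hns : ¬ G.Supereulerian)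
    (X Y : Finset V) (EH : Multiset (Sym2 V))
    (hsub : EH ≤ G.edges)
    (hbip : Multigraph.IsBipartition X Y EH)
    (hX7 : X.card ≤ 7) (hXY : X.card ≤ Y.card)
    (hdeg : ∀ y ∈ Y, 3 ≤ Multigraph.degIn EH y) :
    (G.edges = EH ∧ G.FVal = 3 ∧ ¬ G.HasFourCycle) ∧ False := by
  exact (Hyp.final G hred hn X Y EH hsub hbip hX7 hdeg).elim
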